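/- arXiv:2006.14458 — 6 statements merged into one kernel-verified Lean document; each statement's English description precedes it below -/
import Mathlib

section
/- Every sign pattern of type 1 is canonical: if a sign pattern σ of length d+1 is such that all its entries in even positions are equal or all its entries in odd positions are equal, then every monic hyperbolic polynomial of degree d with all coefficients nonzero and pairwise distinct moduli of roots that realizes σ has its moduli of roots in the canonical order. -/
open Polynomial

/-- A sign pattern of length `d+1`, encoded as a function `ℕ → ℝ`:
its relevant values are at positions `0, …, d` (position `k` carries the sign of the
coefficient of `x^(d-k)`), each equal to `1` or `-1`, and the leading sign is `+1`. -/
def IsSignPattern (d : ℕ) (sp : ℕ → ℝ) : Prop :=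
  sp 0 = 1 ∧ ∀ k ≤ d, sp k = 1 ∨ sp k = -1

/-- `P` is a monic hyperbolic polynomial of degree `d` (it splits into real linear
factors `∏ (X - γ j)`), all of whose coefficients are nonzero, whose roots
`γ 0, …, γ (d-1)` are listed so that their moduli are strictly increasing
(in particular the moduli of the roots are pairwise distinct). -/
def HypOrdered (d : ℕ) (P : Polynomial ℝ) (γ : Fin d → ℝ) : Prop :=
  P = ∏ j : Fin d, (X - C (γ j)) ∧
  (∀ j ≤ d, P.coeff j ≠ 0) ∧
  StrictMono (fun j : Fin d => |γ j|)

/-- The monic degree-`d` polynomial `P` realizes the sign pattern `sp`: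
for `k = 0, …, d` the sign of the coefficient of `x^(d-k)` is `sp k`. -/
def Realizes (d : ℕ) (P : Polynomial ℝ) (sp : ℕ → ℝ) : Prop :=
  ∀ k ≤ d, 0 < sp k * P.coeff (d - k)

/-- The moduli of the roots `γ 0 < … < γ (d-1)` (listed by increasing modulus) of `P`
are in the canonical order: the root of `(i+1)`-th smallest modulus is negative exactly
when `a_(i+1) · a_i > 0`. -/
def CanonicalOrder (d : ℕ) (P : Polynomial ℝ) (γ : Fin d → ℝ) : Prop :=
  ∀ i : Fin d, (γ i < 0 ↔ 0 < P.coeff ((i : ℕ) + 1) * P.coeff (i : ℕ))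

/-- A sign pattern is canonical if every monic hyperbolic polynomial with all
coefficients nonzero and pairwise distinct moduli of roots realizing it has its
moduli of roots in the canonical order. -/
def IsCanonical (d : ℕ) (sp : ℕ → ℝ) : Prop :=
  ∀ (P : Polynomial ℝ) (γ : Fin d → ℝ),
    HypOrdered d P γ → Realizes d P sp → CanonicalOrder d P γ

/-- `sp` is the sign pattern `Σ_{m 0, …, m (s-1)}` of length `d+1`: it consists of
`m 0` signs `+1`, followed by `m 1` signs `-1`, followed by `m 2` signs `+1`, and so on. -/
def IsSigmaOf (d s : ℕ) (m : ℕ → ℕ) (sp : ℕ → ℝ) : Prop :=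
  (∀ i < s, 1 ≤ m i) ∧ (∑ i ∈ Finset.range s, m i = d + 1) ∧
  ∀ i k : ℕ, i < s → (∑ j ∈ Finset.range i, m j) ≤ k →
    k < (∑ j ∈ Finset.range (i + 1), m j) → sp k = (-1) ^ i

/-- A sign pattern is of type 1 if all its entries in even positions are equal
or all its entries in odd positions are equal. -/
def Type1 (d : ℕ) (sp : ℕ → ℝ) : Prop :=
  (∀ j ≤ d, ∀ k ≤ d, Even j → Even k → sp j = sp k) ∨
  (∀ j ≤ d, ∀ k ≤ d, Odd j → Odd k → sp j = sp k)

lemma sort_exists (g : ℝ → ℝ) (S : Finset ℝ) : Set.InjOn g S →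
    ∃ f : ℕ → ℝ, (Finset.range S.card).image f = S ∧
      ∀ i j, i < j → j < S.card → g (f i) < g (f j) := by
  induction S using Finset.induction_on_max_value g with
  | empty => intro _; exact ⟨fun _ => 0, by simp, by simp⟩
  | insert a s has hmax ih =>
    intro hinj
    obtain ⟨f, hf, hlt⟩ := ih (hinj.mono (by simp))
    have hmem : ∀ i, i < s.card → f i ∈ s := fun i hi => by
      rw [← hf]; exact Finset.mem_image_of_mem _ (Finset.mem_range.2 hi)
    refine ⟨fun n => if n = s.card then a else f n, ?_, ?_⟩
    · rw [Finset.card_insert_of_notMem has, Finset.range_add_one, Finset.image_insert]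
      simp only [if_true]
      congr 1
      rw [← hf]
      rw [hf]
      conv_rhs => rw [← hf]
      apply Finset.image_congr
      intro i hi
      have : i < s.card := by simpa using hi
      simp [this.ne]
    · intro i j hij hj
      rw [Finset.card_insert_of_notMem has] at hj
      have hi : i ≠ s.card := by omega
      simp only [hi, if_false]
      split_ifs with h
      · have hfi := hmem i (by omega)
        refine lt_of_le_of_ne (hmax _ hfi) ?_
        intro h2
        have := hinj (by simp [hfi]) (by simp) h2
        exact has (this ▸ hfi)
      · exact hlt i j hij (by omega)

lemma cnt_eq (f : ℕ → ℝ) (n : ℕ) (A : Finset ℝ) (hA : (Finset.range n).image f = A)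
    (hinj : Set.InjOn f (Finset.range n)) (p : ℝ → Prop) [DecidablePred p] :
    (A.filter p).card = ((Finset.range n).filter (fun i => p (f i))).card := by
  rw [← hA, Finset.filter_image, Finset.card_image_of_injOn]
  exact hinj.mono (Finset.coe_subset.2 (Finset.filter_subset _ _))

/-- combinatorial core -/
lemma core_lemma (d : ℕ) (α β : ℕ → ℝ)
    (hα : ∀ i j, i < j → j < d + 1 → |α j| < |α i|)
    (hβ : ∀ i j, i < j → j < d → |β j| < |β i|)
    (H1 : ∀ y, ((Finset.range d).filter (fun i => β i ≤ y)).card ≤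
      ((Finset.range (d+1)).filter (fun i => α i < y)).card)
    (H2 : ∀ y, ((Finset.range (d+1)).filter (fun i => y < α i)).card ≤
      ((Finset.range d).filter (fun i => y < β i)).card + 1)
    (e : ℕ)
    (hEα : ∀ i < d + 1, α i < 0 →
      ((Finset.range (d+1)).filter (fun j => - α i < α j)).card % 2 = e)
    (hEβ : ∀ i < d, β i < 0 →
      ((Finset.range d).filter (fun j => - β i < β j)).card % 2 = e)
    (t : ℕ) (ht : t < d) (hs : ∀ j < t, 0 < α j * β j) (h1 : 0 < α t) (h2 : β t < 0) :
    False := by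
  have hαle : ∀ i j, i < d + 1 → j < d + 1 → |α j| < |α i| → i < j := by
    intro i j hi hj h
    by_contra hc
    rcases (not_lt.1 hc).lt_or_eq with h' | h'
    · exact absurd (hα j i h' hi) (not_lt.2 h.le)
    · subst h'; exact lt_irrefl _ h
  have hβle : ∀ i j, i < d → j < d → |β j| < |β i| → i < j := by
    intro i j hi hj h
    by_contra hc
    rcases (not_lt.1 hc).lt_or_eq with h' | h'
    · exact absurd (hβ j i h' hi) (not_lt.2 h.le)
    · subst h'; exact lt_irrefl _ h
  have hpos : ∀ j < t, (0 < α j ↔ 0 < β j) := fun j hj => by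
    have := hs j hj
    constructor
    · intro h; exact pos_of_mul_pos_right this h.le
    · intro h; exact pos_of_mul_pos_left this h.le
  have hneg : ∀ j < t, (α j < 0 ↔ β j < 0) := fun j hj => by
    have h := hs j hj
    have h3 := hpos j hj
    constructor
    · intro h'
      by_contra hc
      nlinarith [mul_nonneg (neg_nonneg.2 h'.le) (not_lt.1 hc)]
    · intro h'
      by_contra hc
      nlinarith [mul_nonneg (neg_nonneg.2 h'.le) (not_lt.1 hc)]
  -- counts
  have cA1 : (Finset.range (d+1)).filter (fun i => α t < α i)
      = (Finset.range t).filter (fun i => 0 < α i) := by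
    ext i
    simp only [Finset.mem_filter, Finset.mem_range]
    constructor
    · rintro ⟨hi, h⟩
      have : 0 < α i := h1.trans h
      exact ⟨hαle i t hi (by omega) (by rwa [abs_of_pos h1, abs_of_pos this]), this⟩
    · rintro ⟨hi, h⟩
      have := hα i t hi (by omega)
      rw [abs_of_pos h1, abs_of_pos h] at this
      exact ⟨by omega, this⟩
  have cB1 : (Finset.range d).filter (fun i => -β t < β i)
      = (Finset.range t).filter (fun i => 0 < α i) := by
    ext i
    simp only [Finset.mem_filter, Finset.mem_range]
    constructor
    · rintro ⟨hi, h⟩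
      have h0 : 0 < β i := by linarith
      have hit := hβle i t hi (by omega) (by rwa [abs_of_neg h2, abs_of_pos h0])
      exact ⟨hit, (hpos i hit).2 h0⟩
    · rintro ⟨hi, h⟩
      have := hβ i t hi (by omega)
      rw [abs_of_neg h2, abs_of_pos ((hpos i hi).1 h)] at this
      exact ⟨by omega, this⟩
  have cA2 : (Finset.range (d+1)).filter (fun i => α i < -α t)
      = (Finset.range t).filter (fun i => α i < 0) := by
    ext i
    simp only [Finset.mem_filter, Finset.mem_range]
    constructor
    · rintro ⟨hi, h⟩
      have : α i < 0 := by linarith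
      exact ⟨hαle i t hi (by omega) (by rw [abs_of_pos h1, abs_of_neg this]; linarith), this⟩
    · rintro ⟨hi, h⟩
      have := hα i t hi (by omega)
      rw [abs_of_pos h1, abs_of_neg h] at this
      exact ⟨by omega, by linarith⟩
  have cB2 : (Finset.range d).filter (fun i => β i ≤ β t)
      = insert t ((Finset.range t).filter (fun i => α i < 0)) := by
    ext i
    simp only [Finset.mem_filter, Finset.mem_range, Finset.mem_insert]
    constructor
    · rintro ⟨hi, h⟩
      by_cases hit : i = t
      · exact Or.inl hit
      right
      have h0 : β i < 0 := by linarith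
      have hit : i < t := by
        by_contra hc
        have := hβ t i (by omega) hi
        rw [abs_of_neg h2, abs_of_neg h0] at this
        linarith
      exact ⟨hit, (hneg i hit).2 h0⟩
    · rintro (rfl | ⟨hi, h⟩)
      · exact ⟨ht, le_rfl⟩
      have := hβ i t hi (by omega)
      rw [abs_of_neg h2, abs_of_neg ((hneg i hi).1 h)] at this
      exact ⟨by omega, by linarith⟩
  have k1 := H1 (β t)
  rw [cB2, Finset.card_insert_of_notMem (by simp), ← cA2] at k1
  obtain ⟨i, hi1, hi2⟩ := Finset.exists_mem_notMem_of_card_lt_card (Nat.lt_of_succ_le k1)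
  simp only [Finset.mem_filter, Finset.mem_range, not_and, not_lt] at hi1 hi2
  obtain ⟨hid, hi1⟩ := hi1
  have hi2 := hi2 hid
  have hi0 : α i < 0 := by linarith
  have hne : -α i < α t := by
    refine lt_of_le_of_ne (by linarith) ?_
    intro h
    have hab : |α i| = |α t| := by rw [abs_of_neg hi0, abs_of_pos h1, h]
    rcases lt_trichotomy i t with h' | h' | h'
    · exact absurd (hα i t h' (by omega)) (by simp [hab])
    · subst h'; linarith
    · exact absurd (hα t i h' (by omega)) (by simp [hab])
  have k2 := H2 (-α i)
  have k3 : ((Finset.range d).filter (fun j => -α i < β j)).card ≤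
      ((Finset.range d).filter (fun j => -β t < β j)).card := by
    apply Finset.card_le_card
    intro j
    simp only [Finset.mem_filter, Finset.mem_range]
    rintro ⟨h, h'⟩
    exact ⟨h, by linarith⟩
  have k4 : ((Finset.range (d+1)).filter (fun j => α t < α j)).card <
      ((Finset.range (d+1)).filter (fun j => -α i < α j)).card := by
    apply Finset.card_lt_card
    rw [Finset.ssubset_iff_of_subset]
    · refine ⟨t, ?_, ?_⟩
      · simp only [Finset.mem_filter, Finset.mem_range]; exact ⟨by omega, hne⟩
      · simp
    · intro j
      simp only [Finset.mem_filter, Finset.mem_range]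
      rintro ⟨h, h'⟩
      exact ⟨h, by linarith⟩
  have k5 := hEα i hid hi0
  have k6 := hEβ t ht h2
  rw [cA1] at k4
  rw [cB1] at k3 k6
  omega

lemma sign_prod (n : ℕ) (f : ℕ → ℝ) (c : ℝ) :
    0 ≤ (-1 : ℝ) ^ ((Finset.range n).filter (fun j => c < f j)).card *
      ∏ j ∈ Finset.range n, (c - f j) := by
  induction n with
  | zero => simp
  | succ n ih =>
    rw [Finset.prod_range_succ, Finset.range_add_one, Finset.filter_insert]
    split_ifs with h
    · rw [Finset.card_insert_of_notMem (by simp), pow_succ]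
      nlinarith [mul_nonneg ih (sub_nonneg.2 h.le)]
    · nlinarith [mul_nonneg ih (sub_nonneg.2 (not_lt.1 h))]

lemma parity_of_sign (n : ℕ) (f : ℕ → ℝ) (c ε : ℝ)
    (h : 0 < ε * ∏ j ∈ Finset.range n, (c - f j)) :
    ((Finset.range n).filter (fun j => c < f j)).card % 2 = if 0 < ε then 0 else 1 := by
  have := sign_prod n f c
  rcases Nat.even_or_odd ((Finset.range n).filter (fun j => c < f j)).card with h' | h'
  · rw [h'.neg_one_pow, one_mul] at this
    rw [if_pos (pos_of_mul_pos_left h this)]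
    exact Nat.even_iff.1 h'
  · rw [h'.neg_one_pow] at this
    rw [if_neg]
    · exact Nat.odd_iff.1 h'
    · intro hc
      have := pos_of_mul_pos_right h hc.le
      linarith

/-- definite class evaluation -/
lemma definite_eval (d : ℕ) (hd : 1 ≤ d) (P : Polynomial ℝ) (hP : P.natDegree = d) (r : ℕ)
    (hr : r < 2) (ε : ℝ) (hD : ∀ k ≤ d, k % 2 = r → 0 < ε * P.coeff (d - k)) (c : ℝ) (hc : 0 < c) :
    0 < ε * (P.eval c + (-1) ^ (d + r) * P.eval (-c)) := by
  rw [Polynomial.eval_eq_sum_range, Polynomial.eval_eq_sum_range, hP, Finset.mul_sum,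
    ← Finset.sum_add_distrib, Finset.mul_sum]
  have hterm : ∀ j, ε * (P.coeff j * c ^ j + (-1) ^ (d + r) * (P.coeff j * (-c) ^ j)) =
      ε * P.coeff j * c ^ j * (1 + (-1) ^ (d + r + j)) := by
    intro j
    rw [neg_pow c j, pow_add (-1 : ℝ) (d + r) j]; ring
  apply Finset.sum_pos'
  · intro j hj
    rw [Finset.mem_range] at hj
    rw [hterm]
    rcases Nat.even_or_odd (d + r + j) with h | h
    · rw [h.neg_one_pow]
      have := hD (d - j) (by omega) (by rw [Nat.even_iff] at h; omega)
      rw [show d - (d - j) = j by omega] at this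
      positivity
    · rw [h.neg_one_pow]; simp
  · refine ⟨d - r, by rw [Finset.mem_range]; omega, ?_⟩
    rw [hterm, Even.neg_one_pow (by rw [Nat.even_iff]; omega)]
    have := hD r (by omega) (by omega)
    positivity

lemma poly_facts (n : ℕ) (l : ℝ) (hl : 0 < l) (f : ℕ → ℝ) (P : Polynomial ℝ)
    (hP : P = C l * ∏ j ∈ Finset.range n, (X - C (f j))) :
    P.natDegree = n ∧ P.leadingCoeff = l ∧
      ∀ x, P.eval x = l * ∏ j ∈ Finset.range n, (x - f j) := by
  refine ⟨?_, ?_, ?_⟩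
  · rw [hP, Polynomial.natDegree_C_mul hl.ne', Polynomial.natDegree_finset_prod_X_sub_C_eq_card]
    simp
  · rw [hP, Polynomial.leadingCoeff_mul, Polynomial.leadingCoeff_C,
      (Polynomial.monic_prod_X_sub_C _ _).leadingCoeff, mul_one]
  · intro x
    rw [hP]; simp [Polynomial.eval_prod]

lemma parity_neg (d : ℕ) (hd : 1 ≤ d) (l : ℝ) (hl : 0 < l) (f : ℕ → ℝ) (P : Polynomial ℝ)
    (hP : P = C l * ∏ j ∈ Finset.range d, (X - C (f j))) (r : ℕ)
    (hr : r < 2) (ε : ℝ) (hD : ∀ k ≤ d, k % 2 = r → 0 < ε * P.coeff (d - k))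
    (i : ℕ) (hi : i < d) (h0 : f i < 0) :
    0 < ε * ∏ j ∈ Finset.range d, (-f i - f j) := by
  obtain ⟨h1, -, h3⟩ := poly_facts d l hl f P hP
  have := definite_eval d hd P h1 r hr ε hD (-f i) (by linarith)
  have h4 : ∏ j ∈ Finset.range d, (f i - f j) = 0 :=
    Finset.prod_eq_zero (Finset.mem_range.2 hi) (sub_self _)
  rw [neg_neg, h3, h3 (f i), h4] at this
  simp only [mul_zero, add_zero] at this
  rw [mul_left_comm] at this
  exact pos_of_mul_pos_right this hl.le

lemma parity_pos (d : ℕ) (hd : 1 ≤ d) (l : ℝ) (hl : 0 < l) (f : ℕ → ℝ) (P : Polynomial ℝ)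
    (hP : P = C l * ∏ j ∈ Finset.range d, (X - C (f j))) (r : ℕ)
    (hr : r < 2) (ε : ℝ) (hD : ∀ k ≤ d, k % 2 = r → 0 < ε * P.coeff (d - k))
    (i : ℕ) (hi : i < d) (h0 : 0 < f i) :
    0 < (ε * (-1) ^ r) * ∏ j ∈ Finset.range d, (f i - -f j) := by
  obtain ⟨h1, -, h3⟩ := poly_facts d l hl f P hP
  have := definite_eval d hd P h1 r hr ε hD (f i) h0
  rw [h3, h3 (-f i), Finset.prod_eq_zero (Finset.mem_range.2 hi) (sub_self _)] at this
  have h4 : ∏ j ∈ Finset.range d, (-f i - f j) =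
      (-1) ^ d * ∏ j ∈ Finset.range d, (f i - -f j) := by
    have : ∀ j ∈ Finset.range d, -f i - f j = (-1) * (f i - -f j) := by intros; ring
    rw [Finset.prod_congr rfl this, Finset.prod_mul_distrib]; simp
  rw [h4] at this
  have h5 : ((-1 : ℝ) ^ d) * (-1) ^ d = 1 := by rw [← mul_pow]; simp
  have h6 : ε * (l * 0 + (-1) ^ (d + r) * (l * ((-1) ^ d * ∏ j ∈ Finset.range d, (f i - -f j))))
      = l * (ε * (-1) ^ r * ∏ j ∈ Finset.range d, (f i - -f j)) * ((-1 : ℝ) ^ d * (-1) ^ d) := by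
    rw [pow_add]; ring
  rw [h6, h5, mul_one] at this
  exact pos_of_mul_pos_right this hl.le

lemma no_opp (d : ℕ) (hd : 1 ≤ d) (l : ℝ) (hl : 0 < l) (f : ℕ → ℝ) (P : Polynomial ℝ)
    (hP : P = C l * ∏ j ∈ Finset.range d, (X - C (f j))) (r : ℕ)
    (hr : r < 2) (ε : ℝ) (hD : ∀ k ≤ d, k % 2 = r → 0 < ε * P.coeff (d - k))
    (i j : ℕ) (hi : i < d) (hj : j < d) (h0 : f i < 0) (h : f j = - f i) : False := by
  have := parity_neg d hd l hl f P hP r hr ε hD i hi h0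
  rw [Finset.prod_eq_zero (Finset.mem_range.2 hj) (by rw [h]; ring)] at this
  simp at this

/-- Rolle: interlacing -/
lemma rolle (d : ℕ) (l : ℝ) (hl : 0 < l) (a : ℕ → ℝ) (P : Polynomial ℝ)
    (ha : ∀ i j, i < j → j < d + 1 → a i < a j)
    (hP : P = C l * ∏ j ∈ Finset.range (d + 1), (X - C (a j))) :
    ∃ b : ℕ → ℝ, (∀ i < d, a i < b i ∧ b i < a (i + 1)) ∧
      derivative P = C (l * (d + 1)) * ∏ j ∈ Finset.range d, (X - C (b j)) := by
  obtain ⟨h1, h2, h3⟩ := poly_facts (d + 1) l hl a P hP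
  have hroot : ∀ i < d + 1, P.eval (a i) = 0 := fun i hi => by
    rw [h3, Finset.prod_eq_zero (Finset.mem_range.2 hi) (sub_self _), mul_zero]
  have hex : ∀ i, ∃ x, i < d → (a i < x ∧ x < a (i + 1)) ∧ (derivative P).eval x = 0 := by
    intro i
    by_cases hi : i < d
    · obtain ⟨x, hx, hx'⟩ := exists_deriv_eq_zero (f := fun x => P.eval x)
        (ha i (i+1) (by omega) (by omega)) P.continuous.continuousOn
        ((hroot i (by omega)).trans (hroot (i+1) (by omega)).symm)
      refine ⟨x, fun _ => ⟨hx, ?_⟩⟩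
      rwa [Polynomial.deriv] at hx'
    · exact ⟨0, fun h => absurd h hi⟩
  choose b hb using hex
  refine ⟨b, fun i hi => (hb i hi).1, ?_⟩
  have hmono : ∀ i j, i < j → j < d → b i < b j := by
    intro i j hij hj
    have h4 := (hb i (by omega)).1.2
    have h5 := (hb j hj).1.1
    rcases (Nat.succ_le_of_lt hij).lt_or_eq with h | h
    · have := ha (i+1) j h (by omega)
      linarith
    · rw [← h] at h5 ⊢; exact h4.trans h5
  have hinj : Set.InjOn b (Finset.range d) := by
    intro i hi j hj h
    simp only [Finset.coe_range, Set.mem_Iio] at hi hj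
    rcases lt_trichotomy i j with h' | h' | h'
    · exact absurd h (hmono i j h' hj).ne
    · exact h'
    · exact absurd h.symm (hmono j i h' hi).ne
  have hdeg : (derivative P).natDegree = d := by
    rw [Polynomial.natDegree_derivative, h1]; rfl
  have hlead : (derivative P).leadingCoeff = l * (d + 1) := by
    rw [Polynomial.leadingCoeff, hdeg, Polynomial.coeff_derivative, ← h2, Polynomial.leadingCoeff,
      h1]
  have hne : derivative P ≠ 0 := by
    rw [← Polynomial.leadingCoeff_ne_zero, hlead]; positivity
  have hroots : ((Finset.range d).image b).val = (derivative P).roots := by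
    apply Multiset.eq_of_le_of_card_le
    · apply Finset.val_le_iff_val_subset.2
      intro x hx
      simp only [Finset.mem_val, Finset.mem_image, Finset.mem_range] at hx
      obtain ⟨i, hi, rfl⟩ := hx
      rw [Polynomial.mem_roots hne]
      exact (hb i hi).2
    · rw [Finset.card_val, Finset.card_image_of_injOn hinj, Finset.card_range, ← hdeg]
      exact Polynomial.card_roots' _
  have := Polynomial.C_leadingCoeff_mul_prod_multiset_X_sub_C (p := derivative P) (by
    rw [← hroots, Finset.card_val, Finset.card_image_of_injOn hinj, Finset.card_range, hdeg])
  rw [← this, hlead, ← hroots, ← Finset.prod_image (s := Finset.range d) (g := b)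
    (f := fun x => X - C x) hinj]
  rfl

lemma prod_reindex (n : ℕ) (f g : ℕ → ℝ) (hf : Set.InjOn f (Finset.range n))
    (hg : Set.InjOn g (Finset.range n))
    (h : (Finset.range n).image f = (Finset.range n).image g) :
    ∏ j ∈ Finset.range n, (X - C (f j)) = ∏ j ∈ Finset.range n, (X - C (g j)) := by
  rw [← Finset.prod_image (s := Finset.range n) (g := f) (f := fun x => X - C x) hf,
    ← Finset.prod_image (s := Finset.range n) (g := g) (f := fun x => X - C x) hg, h]

lemma injOn_of_lt (n : ℕ) (f : ℕ → ℝ) (g : ℝ → ℝ) (h : ∀ i j, i < j → j < n → g (f i) < g (f j)) :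
    Set.InjOn f (Finset.range n) := by
  intro i hi j hj he
  simp only [Finset.coe_range, Set.mem_Iio] at hi hj
  rcases lt_trichotomy i j with h' | h' | h'
  · exact absurd (congrArg g he) (h i j h' hj).ne
  · exact h'
  · exact absurd (congrArg g he.symm) (h j i h' hi).ne

lemma coeff_zero_eq (n : ℕ) (l : ℝ) (hl : 0 < l) (f : ℕ → ℝ) (P : Polynomial ℝ)
    (hP : P = C l * ∏ j ∈ Finset.range n, (X - C (f j))) :
    P.coeff 0 = l * ∏ j ∈ Finset.range n, (-f j) := by
  rw [Polynomial.coeff_zero_eq_eval_zero, (poly_facts n l hl f P hP).2.2]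
  simp

lemma root_ne_zero (n : ℕ) (l : ℝ) (hl : 0 < l) (f : ℕ → ℝ) (P : Polynomial ℝ)
    (hP : P = C l * ∏ j ∈ Finset.range n, (X - C (f j))) (h0 : P.coeff 0 ≠ 0) :
    ∀ i < n, f i ≠ 0 := by
  intro i hi h
  apply h0
  rw [coeff_zero_eq n l hl f P hP, Finset.prod_eq_zero (Finset.mem_range.2 hi) (by rw [h, neg_zero]),
    mul_zero]

lemma interlace_counts (d : ℕ) (a b : ℕ → ℝ) (hab : ∀ i < d, a i < b i ∧ b i < a (i + 1)) (y : ℝ) :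
    ((Finset.range d).filter (fun i => b i ≤ y)).card ≤
      ((Finset.range (d+1)).filter (fun i => a i < y)).card ∧
    ((Finset.range d).filter (fun i => y ≤ b i)).card ≤
      ((Finset.range (d+1)).filter (fun i => y < a i)).card ∧
    ((Finset.range (d+1)).filter (fun i => y < a i)).card ≤
      ((Finset.range d).filter (fun i => y < b i)).card + 1 ∧
    ((Finset.range (d+1)).filter (fun i => a i < y)).card ≤
      ((Finset.range d).filter (fun i => b i < y)).card + 1 := by
  refine ⟨?_, ?_, ?_, ?_⟩
  · apply Finset.card_le_card
    intro i
    simp only [Finset.mem_filter, Finset.mem_range]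
    rintro ⟨h, h'⟩
    exact ⟨by omega, (hab i h).1.trans_le h'⟩
  · apply Finset.card_le_card_of_injOn (fun i => i + 1)
    · intro i
      simp only [Finset.coe_filter, Finset.mem_range, Set.mem_setOf_eq]
      rintro ⟨h, h'⟩
      exact ⟨by omega, h'.trans_lt (hab i h).2⟩
    · intro i _ j _ h
      simpa using h
  · refine le_trans (Finset.card_le_card (t := insert d ((Finset.range d).filter (fun i => y < b i))) ?_)
      (Finset.card_insert_le _ _)
    intro i
    simp only [Finset.mem_filter, Finset.mem_range, Finset.mem_insert]
    rintro ⟨h, h'⟩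
    by_cases hi : i = d
    · exact Or.inl hi
    · exact Or.inr ⟨by omega, h'.trans (hab i (by omega)).1⟩
  · refine le_trans (Finset.card_le_card (t := insert 0
      (((Finset.range d).filter (fun i => b i < y)).image (fun i => i + 1))) ?_)
      ((Finset.card_insert_le _ _).trans (Nat.add_le_add_right Finset.card_image_le 1))
    intro i
    simp only [Finset.mem_filter, Finset.mem_range, Finset.mem_insert, Finset.mem_image]
    rintro ⟨h, h'⟩
    rcases i with _ | i
    · exact Or.inl rfl
    · exact Or.inr ⟨i, ⟨by omega, (hab i (by omega)).2.trans h'⟩, rfl⟩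

lemma main_ind (d : ℕ) : ∀ (l : ℝ) (_ : 0 < l) (f : ℕ → ℝ) (P : Polynomial ℝ)
    (_ : P = C l * ∏ j ∈ Finset.range d, (X - C (f j)))
    (_ : ∀ i j, i < j → j < d → |f j| < |f i|)
    (_ : ∀ j ≤ d, P.coeff j ≠ 0) (r : ℕ)
    (_ : r < 2) (ε : ℝ) (_ : ∀ k ≤ d, k % 2 = r → 0 < ε * P.coeff (d - k)),
    ∀ t < d, 0 < -f t * (P.coeff (d - t) * P.coeff (d - t - 1)) := by
  induction d with
  | zero => intros; omega
  | succ d ih =>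
    intro l hl f P hP hf hc r hr ε hD
    have hf0 := root_ne_zero _ l hl f P hP (hc 0 (by omega))
    obtain ⟨hPdeg, hPlead, -⟩ := poly_facts (d + 1) l hl f P hP
    -- all but the last
    have key : ∀ t < d, 0 < -f t * (P.coeff (d + 1 - t) * P.coeff (d + 1 - t - 1)) := by
      by_cases hd : d = 0
      · intro t ht; omega
      have hd1 : 1 ≤ d := by omega
      have hfinj : Set.InjOn f (Finset.range (d+1)) :=
        injOn_of_lt (d+1) f (fun x => -|x|) (fun i j hij hj => neg_lt_neg (hf i j hij hj))
      obtain ⟨a, haim, ha⟩ := sort_exists id ((Finset.range (d+1)).image f) (Set.injOn_id _)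
      rw [Finset.card_image_of_injOn hfinj, Finset.card_range] at haim ha
      have hainj := injOn_of_lt (d+1) a id ha
      have hPa : P = C l * ∏ j ∈ Finset.range (d + 1), (X - C (a j)) := by
        rw [hP, prod_reindex (d+1) f a hfinj hainj haim.symm]
      obtain ⟨b, hab, hPb⟩ := rolle d l hl a P ha hPa
      have hl' : 0 < l * (d + 1) := by positivity
      have hc' : ∀ j, (derivative P).coeff j = P.coeff (j + 1) * (j + 1) :=
        fun j => Polynomial.coeff_derivative _ _
      have hcne : ∀ j ≤ d, (derivative P).coeff j ≠ 0 := fun j hj => by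
        rw [hc']
        exact mul_ne_zero (hc _ (by omega)) (by positivity)
      have hD' : ∀ k ≤ d, k % 2 = r → 0 < ε * (derivative P).coeff (d - k) := by
        intro k hk hkr
        have := hD k (by omega) hkr
        rw [hc', show d - k + 1 = d + 1 - k by omega, ← mul_assoc]
        positivity
      have hbmono : ∀ i j, i < j → j < d → b i < b j := by
        intro i j hij hj
        have h4 := (hab i (by omega)).2
        have h5 := (hab j hj).1
        rcases (Nat.succ_le_of_lt hij).lt_or_eq with h | h
        · have : a (i+1) < a j := ha (i+1) j h (by omega)
          linarith
        · rw [← h] at h5 ⊢; exact h4.trans h5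
      have hbinj := injOn_of_lt d b id hbmono
      have habs : Set.InjOn (fun x : ℝ => -|x|) ((Finset.range d).image b) := by
        intro x hx y hy hxy
        simp only [Finset.coe_image, Set.mem_image, Finset.coe_range, Set.mem_Iio] at hx hy
        obtain ⟨i, hi, rfl⟩ := hx
        obtain ⟨j, hj, rfl⟩ := hy
        rcases abs_eq_abs.1 (neg_inj.1 hxy) with h | h
        · exact h
        · exfalso
          have hb0 := root_ne_zero _ _ hl' b _ hPb (hcne 0 (by omega)) j hj
          rcases lt_or_gt_of_ne hb0 with h' | h'
          · exact no_opp d hd1 _ hl' b _ hPb r hr ε hD' j i hj hi h' h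
          · exact no_opp d hd1 _ hl' b _ hPb r hr ε hD' i j hi hj (by linarith) (by linarith)
      obtain ⟨β, hβim, hβ⟩ := sort_exists _ _ habs
      rw [Finset.card_image_of_injOn hbinj, Finset.card_range] at hβim hβ
      have hβinj := injOn_of_lt d β (fun x => -|x|) hβ
      have hPβ : derivative P = C (l * (d + 1)) * ∏ j ∈ Finset.range d, (X - C (β j)) := by
        rw [hPb, prod_reindex d b β hbinj hβinj hβim.symm]
      have hβ' : ∀ i j, i < j → j < d → |β j| < |β i| := fun i j hij hj => by
        have := hβ i j hij hj
        simpa using this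
      have hβ0 := root_ne_zero _ _ hl' β _ hPβ (hcne 0 (by omega))
      have IH := ih _ hl' β _ hPβ hβ' hcne r hr ε hD'
      have cf : ∀ (p : ℝ → Prop) [DecidablePred p],
          ((Finset.range (d+1)).filter (fun i => p (f i))).card
          = ((Finset.range (d+1)).filter (fun i => p (a i))).card := fun p _ => by
        rw [← cnt_eq f (d+1) _ rfl hfinj p, ← cnt_eq a (d+1) _ rfl hainj p, haim]
      have cb : ∀ (p : ℝ → Prop) [DecidablePred p],
          ((Finset.range d).filter (fun i => p (β i))).card
          = ((Finset.range d).filter (fun i => p (b i))).card := fun p _ => by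
        rw [← cnt_eq β d _ rfl hβinj p, ← cnt_eq b d _ rfl hbinj p, hβim]
      have same : ∀ t, t < d → 0 < f t * β t := by
        intro t
        induction t using Nat.strong_induction_on with
        | _ t iht =>
        intro ht
        have hs : ∀ j < t, 0 < f j * β j := fun j hj => iht j hj (by omega)
        rcases lt_or_gt_of_ne (hf0 t (by omega)) with h1 | h1 <;>
          rcases lt_or_gt_of_ne (hβ0 t ht) with h2 | h2
        · exact mul_pos_of_neg_of_neg h1 h2
        · exfalso
          refine core_lemma d (fun i => -f i) (fun i => -β i) (by simpa using hf)
            (by simpa using hβ') ?_ ?_ (if 0 < ε * (-1) ^ r then 0 else 1) ?_ ?_ t ht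
            (by simpa using hs) (by simpa using h1) (by simpa using h2)
          · intro y
            have := (interlace_counts d a b hab (-y)).2.1
            rw [← cf (fun x => -y < x), ← cb (fun x => -y ≤ x)] at this
            simpa only [neg_le, neg_lt] using this
          · intro y
            have := (interlace_counts d a b hab (-y)).2.2.2
            rw [← cf (fun x => x < -y), ← cb (fun x => x < -y)] at this
            simpa only [lt_neg] using this
          · intro i hi h
            have := parity_of_sign _ _ _ _ (parity_pos (d+1) (by omega) l hl f P hP r hr ε hD i hi
              (by simpa using h))
            simpa only [neg_neg] using this
          · intro i hi h
            have := parity_of_sign _ _ _ _ (parity_pos d hd1 _ hl' β _ hPβ r hr ε hD' i hi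
              (by simpa using h))
            simpa only [neg_neg] using this
        · exfalso
          refine core_lemma d f β hf hβ' ?_ ?_ (if 0 < ε then 0 else 1) ?_ ?_ t ht hs h1 h2
          · intro y
            have := (interlace_counts d a b hab y).1
            rwa [← cf (fun x => x < y), ← cb (fun x => x ≤ y)] at this
          · intro y
            have := (interlace_counts d a b hab y).2.2.1
            rwa [← cf (fun x => y < x), ← cb (fun x => y < x)] at this
          · intro i hi h
            exact parity_of_sign _ _ _ _ (parity_neg (d+1) (by omega) l hl f P hP r hr ε hD i hi h)
          · intro i hi h
            exact parity_of_sign _ _ _ _ (parity_neg d hd1 _ hl' β _ hPβ r hr ε hD' i hi h)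
        · exact mul_pos h1 h2
      intro t ht
      have h1 := IH t ht
      have h2 := same t ht
      rw [hc', hc', show d - t + 1 = d + 1 - t by omega,
        show d - t - 1 + 1 = d + 1 - t - 1 by omega] at h1
      have h3 : 0 < ((d - t : ℕ) + 1 : ℝ) * ((d - t - 1 : ℕ) + 1 : ℝ) := by positivity
      have h4 : 0 < (-f t * (P.coeff (d + 1 - t) * P.coeff (d + 1 - t - 1))) *
          ((β t) ^ 2 * (((d - t : ℕ) + 1 : ℝ) * ((d - t - 1 : ℕ) + 1 : ℝ))) := by
        have := mul_pos h1 h2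
        refine this.trans_eq ?_
        ring
      exact pos_of_mul_pos_left h4 (by positivity)
    intro t ht
    by_cases htd : t < d
    · exact key t htd
    have : t = d := by omega
    subst this
    have tele : ∀ k ≤ t, 0 < P.coeff (t + 1 - k) * ∏ j ∈ Finset.range k, (-f j) := by
      intro k
      induction k with
      | zero =>
        intro _
        have : P.coeff (t + 1) = l := by rw [← hPlead, Polynomial.leadingCoeff, hPdeg]
        simpa [this] using hl
      | succ k ihk =>
        intro hk
        have h1 := ihk (by omega)
        have h2 := key k (by omega)
        rw [Finset.prod_range_succ, show t + 1 - (k + 1) = t + 1 - k - 1 by omega]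
        have h3 := mul_pos h1 h2
        have h4 : 0 < (P.coeff (t + 1 - k - 1) * ((∏ j ∈ Finset.range k, (-f j)) * -f k)) *
            (P.coeff (t + 1 - k)) ^ 2 := h3.trans_eq (by ring)
        exact pos_of_mul_pos_left h4 (by positivity)
    have h1 := tele t le_rfl
    have h2 := coeff_zero_eq (t + 1) l hl f P hP
    rw [Finset.prod_range_succ] at h2
    have h3 : t + 1 - t = 1 := by omega
    rw [h3] at h1 ⊢
    have h5 : 0 < (P.coeff 0) ^ 2 := by
      have := hc 0 (by omega)
      positivity
    have h4 : 0 < (-f t * (P.coeff 1 * P.coeff 0)) * (l * (∏ j ∈ Finset.range t, (-f j)) ^ 2) := by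
      have h6 : 0 < (f t) ^ 2 := by
        have := hf0 t (by omega)
        positivity
      have := mul_pos (mul_pos (mul_pos h1 (sq_pos_of_pos hl)) h6)
        (pow_pos h1 2 |>.trans_eq rfl)
      have h7 : 0 < P.coeff 1 * ∏ j ∈ Finset.range t, (-f j) := h1
      set p := ∏ j ∈ Finset.range t, (-f j)
      have hp : p ≠ 0 := by rintro h; rw [h] at h7; simp at h7
      rw [h2]
      have h8 : 0 < p ^ 2 := by positivity
      have h9 := mul_pos (mul_pos (mul_pos h7 h8) h6) (sq_pos_of_pos hl)
      exact h9.trans_eq (by ring)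
    exact pos_of_mul_pos_left h4 (by positivity)

/-- every type 1 sign pattern is canonical. -/
theorem type1_is_canonical (d : ℕ) (sp : ℕ → ℝ)
    (hsp : IsSignPattern d sp) (h1 : Type1 d sp) :
    IsCanonical d sp := by
  intro P γ hH hR
  obtain ⟨hP, hc, hmono⟩ := hH
  obtain ⟨r, hr, ε, hD⟩ : ∃ r < 2, ∃ ε : ℝ, ∀ k ≤ d, k % 2 = r → 0 < ε * P.coeff (d - k) := by
    rcases h1 with h | h
    · refine ⟨0, by omega, sp 0, fun k hk hk2 => ?_⟩
      rw [h 0 (by omega) k hk (by simp) (Nat.even_iff.2 hk2)]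
      exact hR k hk
    · refine ⟨1, by omega, sp 1, fun k hk hk2 => ?_⟩
      rw [h 1 (by omega) k hk (by simp) (Nat.odd_iff.2 hk2)]
      exact hR k hk
  set f : ℕ → ℝ := fun n => if h : d - 1 - n < d then γ ⟨d - 1 - n, h⟩ else 0 with hf
  have hfγ : ∀ i : Fin d, f (d - 1 - i) = γ i := by
    intro i
    have hi := i.2
    have : d - 1 - (d - 1 - (i : ℕ)) = i := by omega
    simp [hf, this]
  have hPf : P = C 1 * ∏ j ∈ Finset.range d, (X - C (f j)) := by
    rw [hP, map_one, one_mul, ← Finset.prod_range_reflect, Finset.prod_range]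
    exact Finset.prod_congr rfl fun i _ => by rw [hfγ]
  have hlt : ∀ i j, i < j → j < d → |f j| < |f i| := by
    intro i j hij hj
    have e1 := hfγ ⟨d - 1 - i, by omega⟩
    have e2 := hfγ ⟨d - 1 - j, by omega⟩
    simp only [show d - 1 - (d - 1 - i) = i by omega] at e1
    simp only [show d - 1 - (d - 1 - j) = j by omega] at e2
    rw [e1, e2]
    exact hmono (by rw [Fin.mk_lt_mk]; omega)
  intro i
  have hi := i.2
  have := main_ind d 1 one_pos f P hPf hlt hc r hr ε hD (d - 1 - i) (by omega)
  rw [hfγ, show d - (d - 1 - (i : ℕ)) = i + 1 by omega, Nat.add_sub_cancel] at this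
  constructor
  · intro h
    exact pos_of_mul_pos_right this (by linarith)
  · intro h
    have := pos_of_mul_pos_left this h.le
    linarith
end

section
/- For every integer d ≥ 5, the sign pattern Σ_{1,d−2,1,1} of length d+1, i.e. the sequence (+1, −1, −1, ..., −1, +1, −1) with d−2 consecutive entries −1 followed by +1 and a final −1, is canonical. -/
open Polynomial

lemma aux_inv (α β χ ρ σ : ℝ) (hχ : 0 < χ) (hb : χ < β) (ha : β < α) (h1 : α < ρ) (h2 : α < σ)
    (hS : 0 < α + β + χ - ρ - σ)
    (hf : 0 < α*β + α*χ + β*χ - (α+β+χ)*(ρ+σ) + ρ*σ) : False := by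
  have h3 : α + β + χ - ρ - σ < χ := by linarith
  have h4 : (α + β + χ - ρ - σ)^2 < χ^2 := by nlinarith
  nlinarith [sq_nonneg α, sq_nonneg β, sq_nonneg ρ, sq_nonneg σ]

lemma aux_mid (a b c r s : ℝ) (ha : 0 < a) (hab : a < b) (hbc : b < c) (hr : 0 < r) (hs : 0 < s)
    (p4 : r + s - a - b - c < 0)
    (p2 : a*b*(r+s) + a*c*(r+s) + b*c*(r+s) - a*b*c - (a+b+c)*(r*s) < 0) :
    (r < a ∨ (b < r ∧ r < c)) := by
  have hb : 0 < b := by linarith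
  have hc : 0 < c := by linarith
  have E : (r-a)*(r-b)*(r-c)*((2*r)*(r+s)) = 2*((r + s - a - b - c)*r^4 +
    (a*b*(r+s) + a*c*(r+s) + b*c*(r+s) - a*b*c - (a+b+c)*(r*s))*r^2 + -(a*b*c*(r*s))) := by ring
  have e1 : (r + s - a - b - c)*r^4 < 0 := mul_neg_of_neg_of_pos p4 (by positivity)
  have e2 : (a*b*(r+s) + a*c*(r+s) + b*c*(r+s) - a*b*c - (a+b+c)*(r*s))*r^2 < 0 :=
    mul_neg_of_neg_of_pos p2 (by positivity)
  have e3 : 0 < a*b*c*(r*s) := by positivity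
  have e4 : (r-a)*(r-b)*(r-c)*((2*r)*(r+s)) < 0 := by rw [E]; linarith
  have e5 : (r-a)*(r-b)*(r-c) < 0 := by
    by_contra h
    push Not at h
    have := mul_nonneg h (show 0 ≤ (2*r)*(r+s) by positivity)
    linarith
  by_contra h
  push Not at h
  obtain ⟨h1, h2⟩ := h
  by_cases h3 : b < r
  · have := h2 h3
    have : 0 ≤ (r-a)*(r-b)*(r-c) :=
      mul_nonneg (mul_nonneg (by linarith) (by linarith)) (by linarith)
    linarith
  · push Not at h3
    have : 0 ≤ (r-a)*((b-r)*(c-r)) :=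
      mul_nonneg (by linarith) (mul_nonneg (by linarith) (by linarith))
    have e : (r-a)*((b-r)*(c-r)) = (r-a)*(r-b)*(r-c) := by ring
    linarith

lemma aux_five (a b c r s : ℝ) (ha : 0 < a) (hab : a < b) (hbc : b < c) (hr : 0 < r) (hs : 0 < s)
    (p4 : r + s - a - b - c < 0)
    (p2 : a*b*(r+s) + a*c*(r+s) + b*c*(r+s) - a*b*c - (a+b+c)*(r*s) < 0)
    (p1 : 0 < (a*b+a*c+b*c)*(r*s) - a*b*c*(r+s)) :
    b < r ∧ r < c := by
  have hb : 0 < b := by linarith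
  have hc : 0 < c := by linarith
  have R := aux_mid a b c r s ha hab hbc hr hs p4 p2
  have S := aux_mid a b c s r ha hab hbc hs hr (by linarith) (by nlinarith)
  rcases R with R | R
  swap
  · exact R
  exfalso
  rcases S with S | S
  · refine aux_inv a⁻¹ b⁻¹ c⁻¹ r⁻¹ s⁻¹ (by positivity) (inv_strictAnti₀ hb hbc)
      (inv_strictAnti₀ ha hab) (inv_strictAnti₀ hr R) (inv_strictAnti₀ hs S) ?_ ?_
    · have : a⁻¹ + b⁻¹ + c⁻¹ - r⁻¹ - s⁻¹ =
        ((a*b+a*c+b*c)*(r*s) - a*b*c*(r+s)) / (a*b*c*r*s) := by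
        field_simp; ring
      rw [this]; positivity
    · have : a⁻¹*b⁻¹ + a⁻¹*c⁻¹ + b⁻¹*c⁻¹ - (a⁻¹+b⁻¹+c⁻¹)*(r⁻¹+s⁻¹) + r⁻¹*s⁻¹ =
        -(a*b*(r+s) + a*c*(r+s) + b*c*(r+s) - a*b*c - (a+b+c)*(r*s)) / (a*b*c*r*s) := by
        field_simp; ring
      rw [this]
      exact div_pos (by linarith) (by positivity)
  · have E : -((2*b)*(a+b)*(b+c)*((b-r)*(b-s))) = 2*((r + s - a - b - c)*b^4 +
      (a*b*(r+s) + a*c*(r+s) + b*c*(r+s) - a*b*c - (a+b+c)*(r*s))*b^2 + -(a*b*c*(r*s))) := by ring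
    have e1 : (r + s - a - b - c)*b^4 < 0 := mul_neg_of_neg_of_pos p4 (by positivity)
    have e2 : (a*b*(r+s) + a*c*(r+s) + b*c*(r+s) - a*b*c - (a+b+c)*(r*s))*b^2 < 0 :=
      mul_neg_of_neg_of_pos p2 (by positivity)
    have e3 : 0 < a*b*c*(r*s) := by positivity
    have e5 : (b-r)*(b-s) < 0 := mul_neg_of_pos_of_neg (by linarith) (by linarith [S.1])
    have e6 : (2*b)*(a+b)*(b+c)*((b-r)*(b-s)) < 0 :=
      mul_neg_of_pos_of_neg (by positivity) e5
    linarith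

/-- The part of the sign pattern that is inherited when removing negative roots. -/
def Cond (R : Polynomial ℝ) : Prop :=
  R.Monic ∧ R.coeff 0 < 0 ∧ 0 < R.coeff 1 ∧ R.coeff 2 < 0 ∧ R.nextCoeff < 0

lemma cond_step (g : ℝ) (hg : g < 0) (R : Polynomial ℝ) (h : Cond ((X - C g) * R)) : Cond R := by
  obtain ⟨h0, h1, h2, h3, h4⟩ := h
  have hm : R.Monic := (monic_X_sub_C g).of_mul_monic_left h0
  rw [(monic_X_sub_C g).nextCoeff_mul hm, nextCoeff_X_sub_C] at h4
  rw [sub_mul, coeff_sub, coeff_C_mul] at h1 h2 h3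
  rw [coeff_X_mul_zero] at h1
  rw [show (1:ℕ) = 0 + 1 from rfl, coeff_X_mul] at h2
  rw [show (2:ℕ) = 1 + 1 from rfl, coeff_X_mul] at h3
  have k0 : R.coeff 0 < 0 := by by_contra h; push Not at h; nlinarith
  have k1 : 0 < R.coeff 1 := by by_contra h; push Not at h; simp at h2; nlinarith
  have k2 : R.coeff 2 < 0 := by by_contra h; push Not at h; simp at h3; nlinarith
  exact ⟨hm, k0, k1, k2, by linarith⟩

lemma cond_red {ι : Type*} [DecidableEq ι] (γ : ι → ℝ) (N : Finset ι) (hN : ∀ i ∈ N, γ i < 0)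
    (R : Polynomial ℝ) (h : Cond ((∏ j ∈ N, (X - C (γ j))) * R)) : Cond R := by
  induction N using Finset.induction_on with
  | empty => simpa using h
  | insert a s ha ih =>
    rw [Finset.prod_insert ha, mul_assoc] at h
    exact ih (fun i hi => hN i (Finset.mem_insert_of_mem hi))
      (cond_step _ (hN a (Finset.mem_insert_self _ _)) _ h)

lemma cond_sub {d : ℕ} (γ : Fin d → ℝ) (T : Finset (Fin d)) (hT : ∀ i, i ∉ T → γ i < 0)
    (h : Cond (∏ j, (X - C (γ j)))) : Cond (∏ j ∈ T, (X - C (γ j))) := by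
  rw [← Finset.prod_compl_mul_prod T] at h
  exact cond_red γ Tᶜ (fun i hi => hT i (Finset.mem_compl.mp hi)) _ h

lemma coeff_five (a b c r s : ℝ) (h : Cond ((X - C a) * ((X - C b) * ((X - C c) *
    ((X - C r) * (X - C s)))))) :
    (-r) + (-s) - a - b - c < 0 ∧
    a*b*((-r)+(-s)) + a*c*((-r)+(-s)) + b*c*((-r)+(-s)) - a*b*c - (a+b+c)*((-r)*(-s)) < 0 ∧
    0 < (a*b+a*c+b*c)*((-r)*(-s)) - a*b*c*((-r)+(-s)) := by
  obtain ⟨h0, h1, h2, h3, h4⟩ := h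
  have e : ((X - C a) * ((X - C b) * ((X - C c) * ((X - C r) * (X - C s))))) =
    X^5 + C (-r-s-a-b-c) * X^4 + C (r*s + (r+s)*(a+b+c) + (a*b+a*c+b*c)) * X^3
    + C (a*b*((-r)+(-s)) + a*c*((-r)+(-s)) + b*c*((-r)+(-s)) - a*b*c - (a+b+c)*((-r)*(-s))) * X^2
    + C ((a*b+a*c+b*c)*((-r)*(-s)) - a*b*c*((-r)+(-s))) * X + C (-(a*b*c*r*s)) := by
    simp only [map_add, map_sub, map_mul, map_neg]; ring
  have m := monic_X_sub_C (R := ℝ)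
  rw [(m a).nextCoeff_mul ((m b).mul ((m c).mul ((m r).mul (m s)))),
    (m b).nextCoeff_mul ((m c).mul ((m r).mul (m s))),
    (m c).nextCoeff_mul ((m r).mul (m s)), (m r).nextCoeff_mul (m s)] at h4
  simp only [nextCoeff_X_sub_C] at h4
  rw [e] at h2 h3
  refine ⟨by linarith, ?_, ?_⟩
  · simpa [coeff_X, coeff_C, -map_add, -map_sub, -map_mul, -map_neg, coeff_X_pow] using h3
  · simpa [coeff_X, coeff_C, -map_add, -map_sub, -map_mul, -map_neg, coeff_X_pow] using h2

lemma destutter_aux (n : ℕ) (l : List SignType) :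
    (List.replicate n (-1 : SignType) ++ l).destutter' (· ≠ ·) (-1) =
      l.destutter' (· ≠ ·) (-1) := by
  induction n with
  | zero => simp
  | succ n ih =>
    rw [List.replicate_succ, List.cons_append, List.destutter'_cons_neg _ (by simp)]
    exact ih

lemma signVar_le (d : ℕ) (hd : 5 ≤ d) (P : Polynomial ℝ) (hdeg : P.natDegree = d)
    (hP : P ≠ 0)
    (hs : ∀ k ≤ d, SignType.sign (P.coeff (d - k)) =
      if k = 0 then 1 else if k ≤ d - 2 then -1 else if k = d - 1 then 1 else -1) :
    P.signVariations ≤ 3 := by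
  have hl : P.coeffList.map SignType.sign =
      1 :: -1 :: (List.replicate (d-3) (-1) ++ [1, -1]) := by
    apply List.ext_getElem
    · simp [hP, hdeg]; omega
    · intro k h1 h2
      simp [hP, hdeg] at h1
      have hk := hs k (by omega)
      have : P.coeffList[k]'(by simp [hP, hdeg]; omega) = P.coeff (d - k) := by
        simp [coeffList, withBotSucc_degree_eq_natDegree_add_one hP, hdeg]
      rw [List.getElem_map, this, hk]
      rcases k with _ | _ | k
      · simp
      · simp; omega
      · simp only [List.getElem_cons_succ, List.getElem_append, List.length_replicate]
        rw [if_neg (by omega)]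
        by_cases h3 : k < d - 3
        · rw [if_pos (by omega), dif_pos h3]
          simp
        · rw [if_neg (by omega), dif_neg h3]
          by_cases h4 : k = d - 3
          · rw [if_pos (by omega)]
            subst h4
            simp
          · rw [if_neg (by omega)]
            obtain rfl : k = (d - 3) + 1 := by omega
            simp
  unfold signVariations
  simp only [hl]
  rw [List.filter_eq_self.mpr]
  · rw [List.destutter_cons', List.destutter'_cons_pos _ (by decide), destutter_aux]
    decide
  · intro a ha
    simp at ha
    rcases ha with h | h | h | h | h <;> simp [h]

theorem main_aux (d : ℕ) (hd : 5 ≤ d) (γ : Fin d → ℝ) (P : Polynomial ℝ)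
    (hP : P = ∏ j : Fin d, (X - C (γ j))) (hmono : StrictMono (fun j : Fin d => |γ j|))
    (hs : ∀ k ≤ d, SignType.sign (P.coeff (d - k)) =
      if k = 0 then 1 else if k ≤ d - 2 then -1 else if k = d - 1 then 1 else -1) :
    ∀ i : Fin d, (γ i < 0 ↔ (2 ≤ (i:ℕ) ∧ (i:ℕ) ≤ d - 2)) := by
  have hmon : P.Monic := hP ▸ monic_prod_of_monic _ _ (fun j _ => monic_X_sub_C (γ j))
  have hdeg : P.natDegree = d := by
    rw [hP, natDegree_prod_of_monic _ _ (fun j _ => monic_X_sub_C (γ j))]; simp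
  have hc0 : P.coeff 0 < 0 := by
    have := hs d le_rfl
    rw [Nat.sub_self, if_neg (by omega), if_neg (by omega), if_neg (by omega)] at this
    exact sign_eq_neg_one_iff.mp this
  have hc1 : 0 < P.coeff 1 := by
    have := hs (d-1) (by omega)
    rw [show d - (d-1) = 1 by omega, if_neg (by omega), if_neg (by omega), if_pos rfl] at this
    exact sign_eq_one_iff.mp this
  have hc2 : P.coeff 2 < 0 := by
    have := hs (d-2) (by omega)
    rw [show d - (d-2) = 2 by omega, if_neg (by omega), if_pos le_rfl] at this
    exact sign_eq_neg_one_iff.mp this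
  have hcn : P.nextCoeff < 0 := by
    have := hs 1 (by omega)
    rw [if_neg (by omega), if_pos (by omega)] at this
    rw [nextCoeff_of_natDegree_pos (by omega), hdeg]
    exact sign_eq_neg_one_iff.mp this
  have hcond : Cond (∏ j : Fin d, (X - C (γ j))) := hP ▸ ⟨hmon, hc0, hc1, hc2, hcn⟩
  have hne : ∀ i, γ i ≠ 0 := by
    intro i hi
    have : P.eval 0 = 0 := by
      rw [hP, eval_prod]
      exact Finset.prod_eq_zero (Finset.mem_univ i) (by simp [hi])
    rw [← coeff_zero_eq_eval_zero] at this
    linarith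
  set Pos : Finset (Fin d) := Finset.univ.filter (fun i => 0 < γ i) with hPos
  have memPos : ∀ i, i ∈ Pos ↔ 0 < γ i := by simp [hPos]
  have hcard : Pos.card ≤ 3 := by
    have h1 := roots_countP_pos_le_signVariations P
    have h2 := signVar_le d hd P hdeg hmon.ne_zero hs
    have h3 : P.roots = Finset.univ.val.map γ := by
      rw [hP]
      have := roots_multiset_prod_X_sub_C (Finset.univ.val.map γ)
      rw [Multiset.map_map] at this
      exact this
    rw [h3, Multiset.countP_map] at h1
    exact le_trans h1 h2
  have hcp := cond_sub γ Pos (fun i hi => lt_of_le_of_ne (not_lt.mp (mt (memPos i).mpr hi)) (hne i)) hcond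
  have hodd : Pos.card = 3 := by
    have hdp : (∏ j ∈ Pos, (X - C (γ j))).natDegree = Pos.card := by
      rw [natDegree_prod_of_monic _ _ (fun j _ => monic_X_sub_C (γ j))]; simp
    have h2 : 2 ≤ Pos.card := by
      rw [← hdp]; exact le_natDegree_of_ne_zero hcp.2.2.2.1.ne
    have h3 : Pos.card ≠ 2 := by
      intro h
      have := hcp.2.1
      rw [coeff_zero_eq_eval_zero, eval_prod] at this
      simp only [eval_sub, eval_X, eval_C, zero_sub, Finset.prod_neg, h] at this
      have h4 : 0 < ∏ j ∈ Pos, γ j := Finset.prod_pos (fun j hj => (memPos j).mp hj)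
      norm_num at this
      linarith
    omega
  set f := Pos.orderEmbOfFin hodd with hf
  have hfm : ∀ i, 0 < γ i ↔ i = f 0 ∨ i = f 1 ∨ i = f 2 := by
    intro i
    rw [← memPos, ← Finset.mem_coe, ← Finset.range_orderEmbOfFin Pos hodd]
    simp only [Set.mem_range, ← hf]
    constructor
    · rintro ⟨y, rfl⟩
      fin_cases y <;> simp
    · rintro (h | h | h) <;> exact ⟨_, h.symm⟩
  have h01 : f 0 < f 1 := f.strictMono (by decide)
  have h12 : f 1 < f 2 := f.strictMono (by decide)
  have g0 : 0 < γ (f 0) := (hfm _).2 (by simp)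
  have g1 : 0 < γ (f 1) := (hfm _).2 (by simp)
  have g2 : 0 < γ (f 2) := (hfm _).2 (by simp)
  have key : ∀ m, γ m < 0 → f 1 < m ∧ m < f 2 := by
    intro m hm
    have hmP : m ∉ Pos := fun h => by have := (memPos m).mp h; linarith
    obtain ⟨n, hn⟩ : ∃ n, n ∉ insert m Pos := by
      by_contra h
      push Not at h
      have h1 : insert m Pos = Finset.univ := Finset.eq_univ_iff_forall.mpr h
      have h2 := Finset.card_insert_le m Pos
      rw [h1, Finset.card_univ, Fintype.card_fin] at h2
      omega
    rw [Finset.mem_insert, not_or] at hn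
    have hn' : γ n < 0 := lt_of_le_of_ne (not_lt.mp (mt (memPos n).mpr hn.2)) (hne n)
    have hc := cond_sub γ {f 0, f 1, f 2, m, n} (fun i hi => by
      refine lt_of_le_of_ne (not_lt.mp (mt (hfm i).mp ?_)) (hne i)
      simp only [Finset.mem_insert, Finset.mem_singleton, not_or] at hi
      tauto) hcond
    have n0 : ∀ k, 0 < γ k → k ≠ m ∧ k ≠ n := by
      intro k hk
      constructor <;> rintro rfl <;> linarith
    rw [Finset.prod_insert, Finset.prod_insert, Finset.prod_insert, Finset.prod_insert,
      Finset.prod_singleton] at hc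
    rotate_left
    · simpa using Ne.symm hn.1
    · simpa using n0 _ g2
    · simpa using n0 _ g1
    · simpa using n0 _ g0
    obtain ⟨q4, q2, q1⟩ := coeff_five _ _ _ _ _ hc
    have m01 := hmono h01
    have m12 := hmono h12
    simp only [abs_of_pos g0, abs_of_pos g1, abs_of_pos g2] at m01 m12
    obtain ⟨u, v⟩ := aux_five _ _ _ _ _ g0 m01 m12 (neg_pos.mpr hm) (neg_pos.mpr hn') q4 q2 q1
    constructor
    · apply hmono.lt_iff_lt.mp
      simpa only [abs_of_pos g1, abs_of_neg hm] using u
    · apply hmono.lt_iff_lt.mp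
      simpa only [abs_of_pos g2, abs_of_neg hm] using v
  have dich : ∀ m, (f 1 < m ∧ m < f 2) ∨ m = f 0 ∨ m = f 1 ∨ m = f 2 := by
    intro m
    rcases lt_or_gt_of_ne (hne m) with h | h
    · exact Or.inl (key m h)
    · exact Or.inr ((hfm m).mp h)
  have d0 := dich ⟨0, by omega⟩
  have d1 := dich ⟨1, by omega⟩
  have dl := dich ⟨d-1, by omega⟩
  simp only [Fin.lt_def, Fin.ext_iff] at d0 d1 dl h01 h12
  have b2 := (f 2).isLt
  have v0 : (f 0 : ℕ) = 0 := by omega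
  have v1 : (f 1 : ℕ) = 1 := by omega
  have v2 : (f 2 : ℕ) = d - 1 := by omega
  intro i
  constructor
  · intro h
    have := key i h
    simp only [Fin.lt_def] at this
    omega
  · rintro ⟨h1, h2⟩
    refine lt_of_le_of_ne (not_lt.mp (mt (hfm i).mp ?_)) (hne i)
    simp only [Fin.ext_iff]
    omega

/-- for `d ≥ 5`, the sign pattern `Σ_{1, d-2, 1, 1}`, i.e.
`(+1, -1, …, -1, +1, -1)` with `d-2` consecutive `-1`'s, is canonical. -/
theorem sigma_1_dm2_1_1_canonical (d : ℕ) (hd : 5 ≤ d) (sp : ℕ → ℝ)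
    (hσ : IsSigmaOf d 4 (fun i => if i = 0 then 1 else if i = 1 then d - 2 else 1) sp) :
    IsCanonical d sp := by
  rintro P γ ⟨hP, -, hmono⟩ hR
  obtain ⟨-, -, h⟩ := hσ
  have s0 := h 0
  have s1 := h 1
  have s2 := h 2
  have s3 := h 3
  simp [Finset.sum_range_succ] at s0 s1 s2 s3
  have hs : ∀ k ≤ d, SignType.sign (P.coeff (d - k)) =
      if k = 0 then 1 else if k ≤ d - 2 then -1 else if k = d - 1 then 1 else -1 := by
    intro k hk
    have hk' := hR k hk
    split_ifs with h1 h2 h3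
    · subst h1
      rw [s0] at hk'
      exact sign_eq_one_iff.mpr (by linarith)
    · rw [s1 k (by omega) (by omega)] at hk'
      exact sign_eq_neg_one_iff.mpr (by linarith)
    · rw [s2 k (by omega) (by omega)] at hk'
      exact sign_eq_one_iff.mpr (by linarith)
    · rw [s3 k (by omega) (by omega)] at hk'
      exact sign_eq_neg_one_iff.mpr (by linarith)
  intro i
  rw [main_aux d hd γ P hP hmono hs i]
  have hi := i.isLt
  have a := hs (d - ((i:ℕ)+1)) (by omega)
  have b := hs (d - (i:ℕ)) (by omega)
  rw [show d - (d - ((i:ℕ)+1)) = (i:ℕ)+1 by omega] at a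
  rw [show d - (d - (i:ℕ)) = (i:ℕ) by omega] at b
  rw [← sign_eq_one_iff, sign_mul, a, b]
  split_ifs <;> simp <;> omega
end

section
/- For every integer d ≥ 5, the following three sign patterns of length d+1 are canonical: Σ_{1,1,d−2,1} (the sequence +1, −1, then d−2 entries +1, then −1); Σ_{2,1,1,...,1,3} with d−4 middle components equal to 1 (two entries +1, then d−4 alternating single signs starting with −1, then three equal signs continuing the alternation); and Σ_{3,1,1,...,1,2} with d−4 middle components equal to 1 (three entries +1, then d−4 alternating single signs starting with −1, then two equal signs continuing the alternation). -/
open Polynomial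

namespace CanonSP

lemma reverse_lin {ι : Type*} (s : Finset ι) (g : ι → ℝ) :
    (∏ j ∈ s, (X - C (g j))).reverse = ∏ j ∈ s, (1 - C (g j) * X) := by
  classical
  induction s using Finset.induction_on with
  | empty => simp [← C_1, -map_one]
  | insert a s ha ih =>
    rw [Finset.prod_insert ha, Finset.prod_insert ha, reverse_mul_of_domain, ih]
    congr 1
    rw [reverse, natDegree_X_sub_C, reflect_sub, reflect_one_X, reflect_C, pow_one]

lemma natDegree_lin {ι : Type*} (s : Finset ι) (g : ι → ℝ) :
    (∏ j ∈ s, (X - C (g j))).natDegree = s.card := by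
  simp

lemma coeff_rev_lin {ι : Type*} (s : Finset ι) (g : ι → ℝ) (k : ℕ) (hk : k ≤ s.card) :
    (∏ j ∈ s, (1 - C (g j) * X)).coeff k = (∏ j ∈ s, (X - C (g j))).coeff (s.card - k) := by
  rw [← reverse_lin, coeff_reverse, natDegree_lin, revAt_le hk]

lemma rev_coeffs {ι : Type*} (s : Finset ι) (g : ι → ℝ) :
    (∏ j ∈ s, (1 - C (g j) * X)).coeff 0 = 1 ∧
    (∏ j ∈ s, (1 - C (g j) * X)).coeff 1 = - ∑ j ∈ s, g j ∧
    (∑ j ∈ s, g j) ^ 2 = ∑ j ∈ s, (g j) ^ 2 + 2 * (∏ j ∈ s, (1 - C (g j) * X)).coeff 2 := by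
  classical
  induction s using Finset.induction_on with
  | empty => simp [coeff_one]
  | insert a s ha ih =>
    obtain ⟨h0, h1, h2⟩ := ih
    rw [Finset.prod_insert ha, Finset.sum_insert ha, Finset.sum_insert ha]
    generalize (∏ j ∈ s, (1 - C (g j) * X)) = Q at *
    have e : (1 - C (g a) * X) * Q = Q - C (g a) * (X * Q) := by ring
    rw [e]
    have c1 : (X * Q).coeff 1 = Q.coeff 0 := coeff_X_mul Q 0
    have c2 : (X * Q).coeff 2 = Q.coeff 1 := coeff_X_mul Q 1
    simp only [coeff_sub, coeff_C_mul, c1, c2, h0, h1]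
    refine ⟨by simp, by ring, ?_⟩
    nlinarith [h2]

lemma low_coeffs {ι : Type*} (s : Finset ι) (g : ι → ℝ) (hg : ∀ j ∈ s, g j ≠ 0) :
    (∏ j ∈ s, (X - C (g j))).coeff 0 = ∏ j ∈ s, (- g j) ∧
    (∏ j ∈ s, (X - C (g j))).coeff 1 = - (∏ j ∈ s, (- g j)) * ∑ j ∈ s, (g j)⁻¹ := by
  classical
  induction s using Finset.induction_on with
  | empty => simp [coeff_one]
  | insert a s ha ih =>
    obtain ⟨h0, h1⟩ := ih (fun j hj => hg j (Finset.mem_insert_of_mem hj))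
    have hga := hg a (Finset.mem_insert_self a s)
    rw [Finset.prod_insert ha, Finset.sum_insert ha, Finset.prod_insert ha]
    generalize (∏ j ∈ s, (X - C (g j))) = Q at *
    have e : (X - C (g a)) * Q = X * Q - C (g a) * Q := by ring
    have c1 : (X * Q).coeff 1 = Q.coeff 0 := coeff_X_mul Q 0
    rw [e]
    simp only [coeff_sub, coeff_C_mul, c1, h0, h1]
    refine ⟨by simp, ?_⟩
    field_simp
    ring

lemma pow_card_neg {ι : Type*} (s : Finset ι) (g : ι → ℝ) :
    ∏ j ∈ s, (X - C (- g j)) = C ((-1) ^ s.card) * (∏ j ∈ s, (X - C (g j))).comp (-X) := by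
  rw [prod_comp, map_pow, ← Finset.prod_const, ← Finset.prod_mul_distrib]
  refine Finset.prod_congr rfl fun j _ => ?_
  simp
  ring

lemma canon_m (d : ℕ) (sp : ℕ → ℝ) (h : IsCanonical d sp) :
    IsCanonical d (fun k => (-1) ^ k * sp k) := by
  rintro P γ ⟨hP, hnz, hmono⟩ hR
  set P' : ℝ[X] := ∏ j : Fin d, (X - C (- γ j)) with hP'
  have hc : ∀ j, P'.coeff j = (-1) ^ d * (-1) ^ j * P.coeff j := by
    intro j
    rw [hP', pow_card_neg, ← hP, coeff_C_mul, Finset.card_univ, Fintype.card_fin]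
    have : P.comp (-X) = P.comp (C (-1) * X) := by simp
    rw [this, comp_C_mul_X_coeff]; ring
  have sq : ∀ n : ℕ, ((-1 : ℝ) ^ n) * (-1) ^ n = 1 := fun n => by
    rw [← mul_pow]; simp
  have hne : ∀ n : ℕ, ((-1 : ℝ) ^ n) ≠ 0 := fun n => by simp
  have hcan := h P' (fun j => - γ j) ⟨rfl, fun j hj => by
      rw [hc]; exact mul_ne_zero (mul_ne_zero (hne _) (hne _)) (hnz j hj), by simpa using hmono⟩
    (fun k hk => by
      have := hR k hk
      simp only at this
      rw [hc]
      have e : (-1 : ℝ) ^ d = (-1) ^ k * (-1) ^ (d - k) := by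
        rw [← pow_add]; congr 1; omega
      rw [e]
      calc 0 < _ := this
        _ = (-1) ^ k * sp k * P.coeff (d - k) * ((-1 : ℝ) ^ (d - k) * (-1) ^ (d - k)) := by
            rw [sq, mul_one]
        _ = _ := by ring)
  intro i
  have hi := hcan i
  have e : P'.coeff ((i : ℕ) + 1) * P'.coeff i = - (P.coeff ((i : ℕ) + 1) * P.coeff i) := by
    rw [hc, hc, pow_succ]
    linear_combination (-(P.coeff ((i : ℕ) + 1) * P.coeff i)) * (-1 : ℝ) ^ (i : ℕ) * (-1) ^ (i : ℕ) * sq d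
      - (P.coeff ((i : ℕ) + 1) * P.coeff i) * sq i
  rw [e] at hi
  have hγ : γ i ≠ 0 := by
    intro h0
    apply hnz 0 (Nat.zero_le _)
    rw [hP, coeff_zero_eq_eval_zero, eval_prod]
    exact Finset.prod_eq_zero (Finset.mem_univ i) (by simp [h0])
  have hp : P.coeff ((i : ℕ) + 1) * P.coeff i ≠ 0 :=
    mul_ne_zero (hnz _ i.2) (hnz _ i.2.le)
  constructor
  · intro hlt
    by_contra hcon
    have : 0 < -(P.coeff ((i : ℕ) + 1) * P.coeff i) := by
      have := lt_of_le_of_ne (not_lt.1 hcon) hp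
      linarith
    have := hi.2 this
    linarith
  · intro hlt
    by_contra hcon
    have : 0 < γ i := lt_of_le_of_ne (not_lt.1 hcon) hγ.symm
    have := hi.1 (by linarith)
    linarith

lemma canon_r (d : ℕ) (sp : ℕ → ℝ) (h : IsCanonical d sp) (h0 : sp 0 = 1) :
    IsCanonical d (fun k => sp d * sp (d - k)) := by
  rintro P γ ⟨hP, hnz, hmono⟩ hR
  have hγ : ∀ i, γ i ≠ 0 := by
    intro i h0
    apply hnz 0 (Nat.zero_le _)
    rw [hP, coeff_zero_eq_eval_zero, eval_prod]
    exact Finset.prod_eq_zero (Finset.mem_univ i) (by simp [h0])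
  have hp0 : P.coeff 0 ≠ 0 := hnz 0 (Nat.zero_le _)
  set P' : ℝ[X] := ∏ j : Fin d, (X - C ((γ (Fin.rev j))⁻¹)) with hP'
  have hP'2 : P' = ∏ j : Fin d, (X - C ((γ j)⁻¹)) := by
    rw [hP']
    exact Fintype.prod_equiv Fin.revPerm _ _ (fun j => rfl)
  have hrev : C (P.coeff 0) * P' = ∏ j : Fin d, (1 - C (γ j) * X) := by
    rw [hP'2, hP, (low_coeffs _ γ (fun j _ => hγ j)).1, map_prod, ← Finset.prod_mul_distrib]
    refine Finset.prod_congr rfl fun j _ => ?_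
    have : C (γ j) * C (γ j)⁻¹ = 1 := by rw [← C_mul, mul_inv_cancel₀ (hγ j), C_1]
    rw [C_neg]
    linear_combination this
  have hc : ∀ k ≤ d, P.coeff 0 * P'.coeff k = P.coeff (d - k) := by
    intro k hk
    rw [← coeff_C_mul, hrev, coeff_rev_lin _ _ _ (by simpa using hk), hP]
    simp
  have hcan := h P' (fun j => (γ (Fin.rev j))⁻¹) ⟨rfl, fun j hj h0 => by
      have := hc j hj
      rw [h0, mul_zero] at this
      exact hnz _ (Nat.sub_le _ _) this.symm, by
      intro i j hij
      simp only [abs_inv]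
      exact inv_strictAnti₀ (abs_pos.2 (hγ _)) (hmono (Fin.rev_lt_rev.2 hij))⟩
    (fun k hk => by
      have h1 := hR (d - k) (Nat.sub_le _ _)
      have h2 := hR d le_rfl
      simp only [Nat.sub_self, Nat.sub_sub_self hk, h0, mul_one] at h1 h2
      have e := hc (d - k) (by omega)
      rw [Nat.sub_sub_self hk] at e
      rw [← e] at h1
      have h3 : 0 < (sp d * P.coeff 0) * (sp k * P'.coeff (d - k)) := by
        calc 0 < _ := h1
          _ = _ := by ring
      exact (mul_pos_iff_of_pos_left h2).1 h3)
  intro i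
  have hi := hcan (Fin.rev i)
  simp only [Fin.rev_rev, inv_lt_zero, Fin.val_rev] at hi
  rw [hi]
  have hlt := i.2
  have e1 := hc (d - (i + 1)) (by omega)
  have e2 := hc (d - (i + 1) + 1) (by omega)
  rw [show d - (d - ((i : ℕ) + 1)) = i + 1 by omega] at e1
  rw [show d - (d - ((i : ℕ) + 1) + 1) = i by omega] at e2
  rw [← e1, ← e2]
  have : P.coeff 0 * P'.coeff (d - (↑i + 1)) * (P.coeff 0 * P'.coeff (d - (↑i + 1) + 1)) =
    (P.coeff 0 ^ 2) * (P'.coeff (d - (↑i + 1) + 1) * P'.coeff (d - (↑i + 1))) := by ring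
  rw [this]
  exact (mul_pos_iff_of_pos_left (by positivity)).symm

end CanonSP
namespace CanonSP

/-- one sign change, negative leading term -/
lemma one_change_top (n : ℕ) (c : ℕ → ℝ) (hc : ∀ j ∈ Finset.Ico 1 n, 0 ≤ c j) (β : ℝ) (hβ : 0 < β)
    (hn : 1 ≤ n) (x x' : ℝ) (hx : 0 < x) (hxx : x < x')
    (h : ∑ j ∈ Finset.Ico 1 n, c j * x ^ j - β * x ^ n ≤ 0) :
    ∑ j ∈ Finset.Ico 1 n, c j * x' ^ j - β * x' ^ n < 0 := by
  obtain ⟨r, hr, rfl⟩ : ∃ r, 1 < r ∧ x' = x * r :=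
    ⟨x' / x, by rwa [one_lt_div hx], by field_simp⟩
  have h1 : ∑ j ∈ Finset.Ico 1 n, c j * (x * r) ^ j ≤
      r ^ (n - 1) * ∑ j ∈ Finset.Ico 1 n, c j * x ^ j := by
    rw [Finset.mul_sum]
    refine Finset.sum_le_sum fun j hj => ?_
    have hcj := hc j hj
    rw [Finset.mem_Ico] at hj
    have : r ^ j ≤ r ^ (n - 1) := pow_le_pow_right₀ hr.le (by omega)
    have h2 : 0 ≤ c j * x ^ j := by positivity
    calc c j * (x * r) ^ j = c j * x ^ j * r ^ j := by rw [mul_pow]; ring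
      _ ≤ c j * x ^ j * r ^ (n - 1) := mul_le_mul_of_nonneg_left this h2
      _ = _ := by ring
  have h3 : r ^ (n - 1) < r ^ n := pow_lt_pow_right₀ hr (by omega)
  have h4 : r ^ (n - 1) * ∑ j ∈ Finset.Ico 1 n, c j * x ^ j ≤ r ^ (n - 1) * (β * x ^ n) :=
    mul_le_mul_of_nonneg_left (by linarith) (by positivity)
  have h5 : r ^ (n - 1) * (β * x ^ n) < r ^ n * (β * x ^ n) :=
    mul_lt_mul_of_pos_right h3 (by positivity)
  have h6 : β * (x * r) ^ n = r ^ n * (β * x ^ n) := by rw [mul_pow]; ring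
  linarith

/-- one sign change, negative constant term -/
lemma one_change_bot (n d : ℕ) (c : ℕ → ℝ) (hc : ∀ j ∈ Finset.Ico 1 n, 0 ≤ c j) (κ α : ℝ)
    (hκ : 0 < κ) (hd : d ≠ 0) (x x' : ℝ) (hx : 0 < x) (hxx : x < x')
    (h : 0 ≤ κ * x ^ d + ∑ j ∈ Finset.Ico 1 n, c j * x ^ j - α) :
    0 < κ * x' ^ d + ∑ j ∈ Finset.Ico 1 n, c j * x' ^ j - α := by
  have h1 : ∑ j ∈ Finset.Ico 1 n, c j * x ^ j ≤ ∑ j ∈ Finset.Ico 1 n, c j * x' ^ j :=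
    Finset.sum_le_sum fun j hj =>
      mul_le_mul_of_nonneg_left (pow_le_pow_left₀ hx.le hxx.le _) (hc j hj)
  have h2 : x ^ d < x' ^ d := pow_lt_pow_left₀ hxx hx.le hd
  have := mul_lt_mul_of_pos_left h2 hκ
  linarith

lemma young (k n : ℕ) (hk : k ≤ n) (hn : 0 < n) (r : ℝ) (hr : 0 < r) :
    r ^ k ≤ (1 - k / n : ℝ) + (k / n : ℝ) * r ^ n := by
  have hn' : (0 : ℝ) < n := by exact_mod_cast hn
  have hkn : (k : ℝ) ≤ n := by exact_mod_cast hk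
  have h := Real.geom_mean_le_arith_mean2_weighted (w₁ := 1 - k / n) (w₂ := k / n) (p₁ := 1)
    (p₂ := r ^ n) (by rw [sub_nonneg, div_le_one hn']; exact hkn) (by positivity) zero_le_one
    (by positivity) (by ring)
  rw [Real.one_rpow, one_mul, mul_one, ← Real.rpow_natCast_mul hr.le,
    mul_div_cancel₀ _ hn'.ne', Real.rpow_natCast] at h
  exact h

/-- two sign changes, `- + ... + -` : positivity set is an interval -/
lemma two_change (n : ℕ) (c : ℕ → ℝ) (hc : ∀ j ∈ Finset.Ico 1 n, 0 ≤ c j) (α β : ℝ) (hn : 0 < n)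
    (x b z : ℝ) (hx : 0 < x) (hxb : x < b) (hbz : b < z)
    (h1 : 0 < ∑ j ∈ Finset.Ico 1 n, c j * x ^ j - β * x ^ n - α)
    (h2 : 0 < ∑ j ∈ Finset.Ico 1 n, c j * z ^ j - β * z ^ n - α) :
    0 < ∑ j ∈ Finset.Ico 1 n, c j * b ^ j - β * b ^ n - α := by
  have hb : 0 < b := hx.trans hxb
  set M := ∑ j ∈ Finset.Ico 1 n, c j * b ^ j with hM
  set K := ∑ j ∈ Finset.Ico 1 n, c j * b ^ j * (j / n : ℝ) with hK
  have key : ∀ r, 0 < r → ∑ j ∈ Finset.Ico 1 n, c j * (b * r) ^ j ≤ M - K + K * r ^ n := by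
    intro r hr
    rw [hM, hK, ← Finset.sum_sub_distrib, Finset.sum_mul, ← Finset.sum_add_distrib]
    refine Finset.sum_le_sum fun j hj => ?_
    have hcj := hc j hj
    rw [Finset.mem_Ico] at hj
    have hy := young j n hj.2.le hn r hr
    have h2 : 0 ≤ c j * b ^ j := by positivity
    calc c j * (b * r) ^ j = c j * b ^ j * r ^ j := by rw [mul_pow]; ring
      _ ≤ c j * b ^ j * _ := mul_le_mul_of_nonneg_left hy h2
      _ = _ := by ring
  obtain ⟨r, hr, rfl, hr0⟩ : ∃ r, r < 1 ∧ x = b * r ∧ 0 < r :=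
    ⟨x / b, by rwa [div_lt_one hb], by field_simp, by positivity⟩
  obtain ⟨s, hs, rfl, hs0⟩ : ∃ s, 1 < s ∧ z = b * s ∧ 0 < s :=
    ⟨z / b, by rwa [one_lt_div hb], by field_simp, by have := hb.trans hbz; positivity⟩
  have k1 := key r hr0
  have k2 := key s hs0
  have hr1 : r ^ n < 1 := pow_lt_one₀ hr0.le hr hn.ne'
  have hs1 : 1 < s ^ n := one_lt_pow₀ hs hn.ne'
  rw [mul_pow] at h1 h2
  generalize r ^ n = R at *
  generalize s ^ n = S at *
  set L := K - β * b ^ n with hL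
  have g1 : 0 < M - K - α + L * R := by
    have : L * R = K * R - β * (b ^ n * R) := by rw [hL]; ring
    linarith
  have g2 : 0 < M - K - α + L * S := by
    have : L * S = K * S - β * (b ^ n * S) := by rw [hL]; ring
    linarith
  have : M - β * b ^ n - α = M - K - α + L := by rw [hL]; ring
  rw [this]
  rcases le_total 0 L with h | h
  · nlinarith
  · nlinarith

lemma destutter_ones (m : ℕ) :
    ((List.replicate m (1 : SignType) ++ [-1]).destutter' (· ≠ ·) 1) = [1, -1] := by
  induction m with
  | zero => decide
  | succ m ih =>
    rw [List.replicate_succ, List.cons_append, List.destutter'_cons_neg]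
    · exact ih
    · simp

lemma sign_var (d : ℕ) (hd : 5 ≤ d) (P : ℝ[X]) (hdeg : P.natDegree = d)
    (h0 : P.coeff 0 < 0) (h1 : ∀ j, 1 ≤ j → j ≤ d - 2 → 0 < P.coeff j)
    (h2 : P.coeff (d - 1) < 0) (h3 : 0 < P.coeff d) : P.signVariations ≤ 3 := by
  obtain ⟨m, rfl⟩ : ∃ m, d = m + 3 := ⟨d - 3, by omega⟩
  have hP : P ≠ 0 := by rintro rfl; simp at h3
  have hl : P.coeffList.map SignType.sign = 1 :: -1 :: 1 :: (List.replicate m 1 ++ [-1]) := by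
    rw [coeffList, withBotSucc_degree_eq_natDegree_add_one hP, hdeg]
    rw [List.range_succ, List.range_succ, List.range_succ, List.range_succ_eq_map]
    simp only [List.reverse_append, List.reverse_cons, List.reverse_nil, List.nil_append,
      List.map_cons, List.map_append, List.map_nil, List.cons_append]
    congr 1
    · exact sign_pos h3
    congr 1
    · exact sign_neg h2
    congr 1
    · exact sign_pos (h1 _ (by omega) (by omega))
    congr 1
    · rw [List.eq_replicate_iff]
      refine ⟨by simp, ?_⟩
      intro b hb
      simp only [List.mem_map, List.mem_reverse, List.mem_range] at hb
      obtain ⟨_, ⟨_, ⟨j, hj, rfl⟩, rfl⟩, rfl⟩ := hb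
      exact sign_pos (h1 _ (by omega) (by omega))
    · rw [sign_neg h0]
  unfold signVariations
  simp only [hl]
  have hf : (1 :: -1 :: 1 :: (List.replicate m (1 : SignType) ++ [-1])).filter (fun x => decide (x ≠ 0)) =
      (1 :: -1 :: 1 :: (List.replicate m 1 ++ [-1])) := by
    rw [List.filter_eq_self]
    intro a ha
    simp only [List.mem_cons, List.mem_append, List.mem_replicate] at ha
    simp only [decide_eq_true_eq]
    rcases ha with rfl | rfl | rfl | ⟨_, rfl⟩ | rfl | h
    all_goals first | decide | simp at h
  rw [hf, List.destutter_cons', List.destutter'_cons_pos _ (by decide),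
    List.destutter'_cons_pos _ (by decide), destutter_ones]
  simp

end CanonSP
namespace CanonSP

/-- the sign conditions of the pattern `+ - + ... + -` -/
structure Signs (d : ℕ) (P : ℝ[X]) : Prop where
  deg : P.natDegree = d
  c0 : P.coeff 0 < 0
  mid : ∀ j, 1 ≤ j → j ≤ d - 2 → 0 < P.coeff j
  sub : P.coeff (d - 1) < 0
  top : P.coeff d = 1

lemma eval_form (d : ℕ) (hd : 5 ≤ d) (P : ℝ[X]) (h : Signs d P) (x : ℝ) :
    P.eval x = x ^ d + P.coeff (d - 1) * x ^ (d - 1)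
      + ∑ j ∈ Finset.Ico 1 (d - 1), P.coeff j * x ^ j + P.coeff 0 := by
  rw [eval_eq_sum_range, h.deg, Finset.sum_range_succ, h.top]
  have : d = (d - 1) + 1 := by omega
  have e : ∑ j ∈ Finset.range d, P.coeff j * x ^ j = ∑ j ∈ Finset.range (d - 1), P.coeff j * x ^ j
      + P.coeff (d - 1) * x ^ (d - 1) := by
    conv_lhs => rw [this]
    rw [Finset.sum_range_succ]
  rw [e, Finset.range_eq_Ico, Finset.sum_eq_sum_Ico_succ_bot (by omega)]
  simp
  ring

lemma sum_form (d : ℕ) (P : ℝ[X]) (σ x : ℝ) :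
    ∑ j ∈ Finset.Ico 1 (d - 1), P.coeff j * x ^ j
      + σ * ∑ j ∈ Finset.Ico 1 (d - 1), P.coeff j * (-x) ^ j =
    ∑ j ∈ Finset.Ico 1 (d - 1), (P.coeff j * (1 + σ * (-1) ^ j)) * x ^ j := by
  rw [Finset.mul_sum, ← Finset.sum_add_distrib]
  refine Finset.sum_congr rfl fun j _ => ?_
  rw [neg_pow x]; ring

lemma pm (j : ℕ) : (0 : ℝ) ≤ 1 + 1 * (-1) ^ j ∧ (0 : ℝ) ≤ 1 + (-1) * (-1) ^ j := by
  rcases neg_one_pow_eq_or ℝ j with h | h <;> rw [h] <;> norm_num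

lemma mid_nonneg (d : ℕ) (P : ℝ[X]) (h : Signs d P) :
    (∀ j ∈ Finset.Ico 1 (d - 1), 0 ≤ P.coeff j * (1 + 1 * (-1) ^ j)) ∧
    (∀ j ∈ Finset.Ico 1 (d - 1), 0 ≤ P.coeff j * (1 + (-1) * (-1) ^ j)) := by
  constructor <;> intro j hj <;> rw [Finset.mem_Ico] at hj
  · exact mul_nonneg (h.mid j hj.1 (by omega)).le (pm j).1
  · exact mul_nonneg (h.mid j hj.1 (by omega)).le (pm j).2

lemma even_e (d : ℕ) (hd : 5 ≤ d) (P : ℝ[X]) (h : Signs d P) (hev : Even d) (x : ℝ) :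
    P.eval x + P.eval (-x) = 2 * x ^ d + ∑ j ∈ Finset.Ico 1 (d - 1), (P.coeff j * (1 + 1 * (-1) ^ j)) * x ^ j
      - (- 2 * P.coeff 0) := by
  rw [eval_form d hd P h, eval_form d hd P h, ← sum_form]
  have ho : Odd (d - 1) := Nat.Even.sub_odd (by omega) hev odd_one
  rw [hev.neg_pow, ho.neg_pow]; ring

lemma even_o (d : ℕ) (hd : 5 ≤ d) (P : ℝ[X]) (h : Signs d P) (hev : Even d) (x : ℝ) :
    P.eval x - P.eval (-x) = ∑ j ∈ Finset.Ico 1 (d - 1), (P.coeff j * (1 + (-1) * (-1) ^ j)) * x ^ j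
      - (- 2 * P.coeff (d - 1)) * x ^ (d - 1) := by
  rw [eval_form d hd P h, eval_form d hd P h, ← sum_form]
  have ho : Odd (d - 1) := Nat.Even.sub_odd (by omega) hev odd_one
  rw [hev.neg_pow, ho.neg_pow]; ring

lemma odd_e (d : ℕ) (hd : 5 ≤ d) (P : ℝ[X]) (h : Signs d P) (hev : Odd d) (x : ℝ) :
    P.eval x + P.eval (-x) = ∑ j ∈ Finset.Ico 1 (d - 1), (P.coeff j * (1 + 1 * (-1) ^ j)) * x ^ j
      - (- 2 * P.coeff (d - 1)) * x ^ (d - 1) - (- 2 * P.coeff 0) := by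
  rw [eval_form d hd P h, eval_form d hd P h, ← sum_form]
  have ho : Even (d - 1) := Nat.Odd.sub_odd hev odd_one
  rw [hev.neg_pow, ho.neg_pow]; ring

lemma odd_o (d : ℕ) (hd : 5 ≤ d) (P : ℝ[X]) (h : Signs d P) (hev : Odd d) (x : ℝ) (hx : 0 < x) :
    0 < P.eval x - P.eval (-x) := by
  have : P.eval x - P.eval (-x) =
      2 * x ^ d + ∑ j ∈ Finset.Ico 1 (d - 1), (P.coeff j * (1 + (-1) * (-1) ^ j)) * x ^ j := by
    rw [eval_form d hd P h, eval_form d hd P h, ← sum_form]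
    have ho : Even (d - 1) := Nat.Odd.sub_odd hev odd_one
    rw [hev.neg_pow, ho.neg_pow]; ring
  rw [this]
  have : 0 ≤ ∑ j ∈ Finset.Ico 1 (d - 1), (P.coeff j * (1 + (-1) * (-1) ^ j)) * x ^ j :=
    Finset.sum_nonneg fun j hj => mul_nonneg ((mid_nonneg d P h).2 j hj) (by positivity)
  positivity

lemma even_e_mono (d : ℕ) (hd : 5 ≤ d) (P : ℝ[X]) (h : Signs d P) (hev : Even d) (x x' : ℝ)
    (hx : 0 < x) (hxx : x < x') (h1 : 0 ≤ P.eval x + P.eval (-x)) :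
    0 < P.eval x' + P.eval (-x') := by
  rw [even_e d hd P h hev] at *
  exact one_change_bot _ d _ (mid_nonneg d P h).1 2 _ (by norm_num) (by omega) x x' hx hxx h1

lemma even_o_mono (d : ℕ) (hd : 5 ≤ d) (P : ℝ[X]) (h : Signs d P) (hev : Even d) (x x' : ℝ)
    (hx : 0 < x) (hxx : x < x') (h1 : P.eval x - P.eval (-x) ≤ 0) :
    P.eval x' - P.eval (-x') < 0 := by
  rw [even_o d hd P h hev] at *
  exact one_change_top _ _ (mid_nonneg d P h).2 _ (by linarith [h.sub]) (by omega) x x' hx hxx h1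

lemma odd_e_mid (d : ℕ) (hd : 5 ≤ d) (P : ℝ[X]) (h : Signs d P) (hev : Odd d) (x b z : ℝ)
    (hx : 0 < x) (hxb : x < b) (hbz : b < z) (h1 : 0 < P.eval x + P.eval (-x))
    (h2 : 0 < P.eval z + P.eval (-z)) : 0 < P.eval b + P.eval (-b) := by
  rw [odd_e d hd P h hev] at *
  exact two_change _ _ (mid_nonneg d P h).1 _ _ (by omega) x b z hx hxb hbz h1 h2

/-- Core: no negative root has modulus smaller than `a`, none larger than `b`. -/
lemma core (d : ℕ) (hd : 5 ≤ d) (P : ℝ[X]) (h : Signs d P) {ι : Type*} (N : Finset ι) (g : ι → ℝ)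
    (hN : N.card = d - 3) (hg : ∀ j ∈ N, g j < 0) (a b c : ℝ) (ha : 0 < a) (hab : a < b)
    (hbc : b < c) (hev : ∀ x, P.eval x = (x - a) * (x - b) * (x - c) * ∏ j ∈ N, (x - g j))
    (hna : ∀ j ∈ N, -g j ≠ a) (hnb : ∀ j ∈ N, -g j ≠ b)
    (he1 : 0 < a + b + c + ∑ j ∈ N, g j)
    (he2 : a ^ 2 + b ^ 2 + c ^ 2 + ∑ j ∈ N, g j ^ 2 < (a + b + c + ∑ j ∈ N, g j) ^ 2)
    (hinv : 0 < a⁻¹ + b⁻¹ + c⁻¹ + ∑ j ∈ N, (g j)⁻¹) :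
    (∀ j ∈ N, a < - g j) ∧ (∀ j ∈ N, - g j < b) := by
  have hb : 0 < b := ha.trans hab
  have hc : 0 < c := hb.trans hbc
  have hq : ∀ x, 0 < x → 0 < ∏ j ∈ N, (x - g j) := fun x hx =>
    Finset.prod_pos fun j hj => by linarith [hg j hj]
  have hroot : ∀ j ∈ N, P.eval (- (- g j)) = 0 := fun j hj => by
    rw [hev, neg_neg, Finset.prod_eq_zero hj (sub_self _), mul_zero]
  have hPa : P.eval a = 0 := by rw [hev]; ring
  have hPb : P.eval b = 0 := by rw [hev]; ring
  have hlow : ∀ x, 0 < x → x < a → P.eval x < 0 := fun x hx hxa => by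
    rw [hev]
    refine mul_neg_of_neg_of_pos ?_ (hq x hx)
    exact mul_neg_of_pos_of_neg (mul_pos_of_neg_of_neg (by linarith) (by linarith)) (by linarith)
  have hmid : ∀ x, a < x → x < b → 0 < P.eval x := fun x hx hxa => by
    rw [hev]
    refine mul_pos ?_ (hq x (ha.trans hx))
    exact mul_pos_of_neg_of_neg (mul_neg_of_pos_of_neg (by linarith) (by linarith)) (by linarith)
  have part1 : ∀ j ∈ N, a < - g j := by
    intro j hj
    by_contra hcon
    have hlt : - g j < a := lt_of_le_of_ne (not_lt.1 hcon) (hna j hj)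
    have hy : 0 < - g j := by linarith [hg j hj]
    have hP := hlow _ hy hlt
    have hr := hroot j hj
    rcases Nat.even_or_odd d with hpar | hpar
    · obtain ⟨k, hk, hka⟩ : ∃ k ∈ N, a < - g k := by
        by_contra hall
        push Not at hall
        have hb1 : b⁻¹ < a⁻¹ := inv_strictAnti₀ ha hab
        have hc1 : c⁻¹ < b⁻¹ := inv_strictAnti₀ hb hbc
        have hs : ∑ j ∈ N, (g j)⁻¹ ≤ ∑ j ∈ N, (- a⁻¹) := by
          refine Finset.sum_le_sum fun k hk => ?_
          have h1 : 0 < - g k := by linarith [hg k hk]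
          have h2 := inv_anti₀ h1 (hall k hk)
          rw [inv_neg] at h2
          linarith
        rw [Finset.sum_const, hN, nsmul_eq_mul] at hs
        have h3 : (3 : ℝ) ≤ ((d - 3 : ℕ) : ℝ) := by
          have : 3 ≤ d - 3 := by obtain ⟨m, rfl⟩ := hpar; omega
          exact_mod_cast this
        have : 0 < a⁻¹ := by positivity
        nlinarith
      have hak := hroot k hk
      have o1 : P.eval (- g k) - P.eval (- (- g k)) < 0 :=
        even_o_mono d hd P h hpar (- g j) (- g k) hy (hlt.trans hka) (by rw [hr]; linarith)
      have o2 : P.eval a - P.eval (- a) < 0 :=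
        even_o_mono d hd P h hpar (- g j) a hy hlt (by rw [hr]; linarith)
      have e2 : 0 < P.eval (- g k) + P.eval (- (- g k)) :=
        even_e_mono d hd P h hpar a _ ha hka (by linarith)
      linarith
    · have := odd_o d hd P h hpar _ hy
      linarith
  refine ⟨part1, ?_⟩
  by_contra hcon
  push Not at hcon
  obtain ⟨j, hj, hjb⟩ := hcon
  have hjb : b < - g j := lt_of_le_of_ne hjb (hnb j hj).symm
  have hjr := hroot j hj
  have hall : ∀ k ∈ N, b < - g k := by
    intro k hk
    by_contra hcon
    have hlt : - g k < b := lt_of_le_of_ne (not_lt.1 hcon) (hnb k hk)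
    have hka := part1 k hk
    have hy : 0 < - g k := by linarith
    have hP := hmid _ hka hlt
    have hr := hroot k hk
    rcases Nat.even_or_odd d with hpar | hpar
    · have e1 : 0 < P.eval b + P.eval (-b) :=
        even_e_mono d hd P h hpar (- g k) b hy hlt (by linarith)
      have e2 : 0 < P.eval (- g j) + P.eval (- (- g j)) :=
        even_e_mono d hd P h hpar b _ hb hjb e1.le
      have o2 := even_o_mono d hd P h hpar b (- g j) hb hjb (by linarith)
      linarith
    · have ob := odd_o d hd P h hpar b hb
      have oj := odd_o d hd P h hpar (- g j) (by linarith)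
      have := odd_e_mid d hd P h hpar (- g k) b (- g j) hy hlt hjb (by linarith) (by linarith)
      linarith
  have hs : ∑ j ∈ N, g j ≤ ∑ j ∈ N, (- b) :=
    Finset.sum_le_sum fun k hk => by linarith [hall k hk]
  rw [Finset.sum_const, hN, nsmul_eq_mul] at hs
  have h3 : (2 : ℝ) ≤ ((d - 3 : ℕ) : ℝ) := by
    have : 2 ≤ d - 3 := by omega
    exact_mod_cast this
  have h4 : 0 ≤ ∑ j ∈ N, g j ^ 2 := Finset.sum_nonneg fun _ _ => sq_nonneg _
  have h5 : a + b + c + ∑ j ∈ N, g j < c := by nlinarith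
  nlinarith

end CanonSP
namespace CanonSP

lemma base (d : ℕ) (hd : 5 ≤ d) :
    IsCanonical d (fun k => if k = 1 ∨ k = d then -1 else 1) := by
  rintro P γ ⟨hP, hnz, hmono⟩ hR
  have hγ : ∀ i, γ i ≠ 0 := by
    intro i h0
    apply hnz 0 (Nat.zero_le _)
    rw [hP, coeff_zero_eq_eval_zero, eval_prod]
    exact Finset.prod_eq_zero (Finset.mem_univ i) (by simp [h0])
  have hdeg : P.natDegree = d := by rw [hP, natDegree_lin]; simp
  have htop : P.coeff d = 1 := by
    have hm : P.Monic := by rw [hP]; exact monic_prod_of_monic _ _ fun j _ => monic_X_sub_C _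
    have := hm.coeff_natDegree
    rwa [hdeg] at this
  have hS : Signs d P := by
    refine ⟨hdeg, ?_, ?_, ?_, htop⟩
    · have := hR d le_rfl
      simp at this
      exact this
    · intro j h1 h2
      have := hR (d - j) (Nat.sub_le _ _)
      simp only at this
      rw [if_neg (by omega), Nat.sub_sub_self (by omega), one_mul] at this
      exact this
    · have := hR 1 (by omega)
      simp at this
      exact this
  -- power sums
  obtain ⟨-, r1, r2⟩ := rev_coeffs Finset.univ γ
  rw [coeff_rev_lin _ _ _ (by simp; omega), ← hP, Finset.card_univ, Fintype.card_fin] at r1 r2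
  have he1 : 0 < ∑ j, γ j := by linarith [hS.sub]
  have he2 : ∑ j, γ j ^ 2 < (∑ j, γ j) ^ 2 := by
    linarith [hS.mid (d - 2) (by omega) le_rfl]
  obtain ⟨l0, l1⟩ := low_coeffs Finset.univ γ (fun j _ => hγ j)
  rw [← hP] at l0 l1
  have hinv : 0 < ∑ j, (γ j)⁻¹ := by
    have := hS.mid 1 le_rfl (by omega)
    rw [l1, ← l0] at this
    have h0 : 0 < - P.coeff 0 := by linarith [hS.c0]
    exact (mul_pos_iff_of_pos_left h0).1 this
  set T : Finset (Fin d) := Finset.univ.filter (fun j => 0 < γ j) with hT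
  have hTm : ∀ j, j ∈ T ↔ 0 < γ j := by simp [hT]
  have hneg : ∀ j ∈ Tᶜ, γ j < 0 := fun j hj => by
    rw [Finset.mem_compl, hTm] at hj
    exact lt_of_le_of_ne (not_lt.1 hj) (hγ j)
  have hcard : T.card ≤ 3 := by
    have h1 := roots_countP_pos_le_signVariations (P := P)
    have h2 := sign_var d hd P hdeg hS.c0 hS.mid hS.sub (by rw [htop]; norm_num)
    have h3 : P.roots.countP (0 < ·) = T.card := by
      have : P.roots = Finset.univ.val.map γ := by
        rw [hP]
        have := roots_multiset_prod_X_sub_C (Finset.univ.val.map γ)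
        rw [Multiset.map_map] at this
        exact this
      rw [this, Multiset.countP_map]
      rfl
    omega
  have hodd : ¬ Even T.card := by
    intro hE
    have h0 := hS.c0
    rw [l0, ← Finset.prod_mul_prod_compl T, Finset.prod_neg, hE.neg_one_pow, one_mul] at h0
    have : 0 < (∏ j ∈ T, γ j) * ∏ j ∈ Tᶜ, - γ j :=
      mul_pos (Finset.prod_pos fun j hj => (hTm j).1 hj)
        (Finset.prod_pos fun j hj => by linarith [hneg j hj])
    linarith
  have h13 : T.card = 3 := by
    have : T.card ≠ 0 := fun h => hodd (by rw [h]; simp)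
    have : T.card ≠ 2 := fun h => hodd (by rw [h]; exact even_two)
    have : T.card ≠ 1 := by
      intro h
      obtain ⟨a, ha⟩ := Finset.card_eq_one.1 h
      rw [← Finset.sum_add_sum_compl T, ← Finset.sum_add_sum_compl T γ, ha] at he2
      rw [← Finset.sum_add_sum_compl T γ, ha] at he1
      rw [ha] at hneg
      simp only [Finset.sum_singleton] at he1 he2
      have g1 : ∑ j ∈ ({a} : Finset (Fin d))ᶜ, γ j ≤ 0 :=
        Finset.sum_nonpos fun j hj => (hneg j hj).le
      have g2 : 0 ≤ ∑ j ∈ ({a} : Finset (Fin d))ᶜ, γ j ^ 2 :=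
        Finset.sum_nonneg fun j hj => sq_nonneg _
      nlinarith
    omega
  -- sorted enumeration
  let f := T.orderEmbOfFin h13
  have hfT : ∀ i, f i ∈ T := fun i => Finset.orderEmbOfFin_mem T h13 i
  have h01 : f 0 < f 1 := f.strictMono (by decide)
  have h12 : f 1 < f 2 := f.strictMono (by decide)
  have hTe : T = {f 0, f 1, f 2} := by
    symm
    apply Finset.eq_of_subset_of_card_le
    · intro x hx
      simp only [Finset.mem_insert, Finset.mem_singleton] at hx
      rcases hx with rfl | rfl | rfl <;> exact hfT _
    · rw [h13, Finset.card_eq_three.2 ⟨f 0, f 1, f 2, h01.ne, (h01.trans h12).ne, h12.ne, rfl⟩]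
  generalize f 0 = i1 at *
  generalize f 1 = i2 at *
  generalize f 2 = i3 at *
  have p1 : 0 < γ i1 := by rw [← hTm, hTe]; simp
  have p2 : 0 < γ i2 := by rw [← hTm, hTe]; simp
  have p3 : 0 < γ i3 := by rw [← hTm, hTe]; simp
  have sumT : ∀ F : Fin d → ℝ, ∑ j ∈ T, F j = F i1 + F i2 + F i3 := by
    intro F
    rw [hTe, Finset.sum_insert (by simp [h01.ne, (h01.trans h12).ne]),
      Finset.sum_insert (by simp [h12.ne]), Finset.sum_singleton]; ring
  have prodT : ∀ F : Fin d → ℝ, ∏ j ∈ T, F j = F i1 * F i2 * F i3 := by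
    intro F
    rw [hTe, Finset.prod_insert (by simp [h01.ne, (h01.trans h12).ne]),
      Finset.prod_insert (by simp [h12.ne]), Finset.prod_singleton]; ring
  have m12 : γ i1 < γ i2 := by
    have := hmono h01
    simpa only [abs_of_pos p1, abs_of_pos p2] using this
  have m23 : γ i2 < γ i3 := by
    have := hmono h12
    simpa only [abs_of_pos p3, abs_of_pos p2] using this
  have hne : ∀ j ∈ Tᶜ, ∀ i ∈ T, - γ j ≠ γ i := by
    intro j hj i hi he
    have h1 := hneg j hj
    have h2 := (hTm i).1 hi
    have : j = i := hmono.injective (by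
      simp only [abs_of_neg h1, abs_of_pos h2]; exact he)
    rw [Finset.mem_compl] at hj
    exact hj (this ▸ hi)
  rw [← Finset.sum_add_sum_compl T γ, sumT] at he1
  rw [← Finset.sum_add_sum_compl T γ, ← Finset.sum_add_sum_compl T, sumT, sumT] at he2
  rw [← Finset.sum_add_sum_compl T, sumT] at hinv
  obtain ⟨k1, k2⟩ := core d hd P hS Tᶜ γ (by rw [Finset.card_compl, h13, Fintype.card_fin]) hneg
    (γ i1) (γ i2) (γ i3) p1 m12 m23 (fun x => by
      rw [hP, eval_prod, ← Finset.prod_mul_prod_compl T, prodT]; simp)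
    (fun j hj => hne j hj i1 ((hTm _).2 p1)) (fun j hj => hne j hj i2 ((hTm _).2 p2))
    he1 he2 hinv
  have q1 : ∀ j, j ∉ T → i1 < j := by
    intro j hj
    have hj' := Finset.mem_compl.2 hj
    refine hmono.lt_iff_lt.1 ?_
    simp only [abs_of_pos p1, abs_of_neg (hneg j hj')]
    exact k1 j hj'
  have q2 : ∀ j, j ∉ T → j < i2 := by
    intro j hj
    have hj' := Finset.mem_compl.2 hj
    refine hmono.lt_iff_lt.1 ?_
    simp only [abs_of_pos p2, abs_of_neg (hneg j hj')]
    exact k2 j hj'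
  have hmem : ∀ j, j ∈ T ↔ j = i1 ∨ j = i2 ∨ j = i3 := by
    intro j; rw [hTe]; simp
  have b1 : (i1 : ℕ) = 0 := by
    by_contra hb
    have : (⟨0, by omega⟩ : Fin d) ∉ T := by
      rw [hmem]; simp only [Fin.ext_iff]; omega
    have := q1 _ this
    simp [Fin.lt_def] at this
  have b3 : (i3 : ℕ) = d - 1 := by
    by_contra hb
    have h3 := i3.2
    have : (⟨d - 1, by omega⟩ : Fin d) ∉ T := by
      rw [hmem]; simp only [Fin.ext_iff]; omega
    have := q2 _ this
    simp only [Fin.lt_def] at this h12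
    omega
  have b2 : (i2 : ℕ) = d - 2 := by
    by_contra hb
    have h3 := i2.2
    have : (⟨d - 2, by omega⟩ : Fin d) ∉ T := by
      rw [hmem]; simp only [Fin.ext_iff]; omega
    have := q2 _ this
    simp only [Fin.lt_def] at this h12
    omega
  intro i
  have hlt := i.2
  have hsub := hS.sub
  have hc0 := hS.c0
  by_cases hi : i ∈ T
  · have hpos := (hTm i).1 hi
    have hp : P.coeff ((i : ℕ) + 1) * P.coeff i < 0 := by
      rw [hmem] at hi
      rcases hi with rfl | rfl | rfl
      · rw [b1]
        exact mul_neg_of_pos_of_neg (hS.mid 1 le_rfl (by omega)) hc0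
      · rw [b2, show d - 2 + 1 = d - 1 by omega]
        exact mul_neg_of_neg_of_pos hsub (hS.mid _ (by omega) le_rfl)
      · rw [b3, show d - 1 + 1 = d by omega, htop]
        linarith
    constructor <;> intro _ <;> linarith
  · have hn := hneg i (Finset.mem_compl.2 hi)
    have hp : 0 < P.coeff ((i : ℕ) + 1) * P.coeff i := by
      have u1 := q1 i hi
      have u2 := q2 i hi
      simp only [Fin.lt_def] at u1 u2
      exact mul_pos (hS.mid _ (by omega) (by omega)) (hS.mid _ (by omega) (by omega))
    exact ⟨fun _ => hp, fun _ => hn⟩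

lemma canon_congr (d : ℕ) (sp sp' : ℕ → ℝ) (h : IsCanonical d sp) (he : ∀ k ≤ d, sp' k = sp k) :
    IsCanonical d sp' := fun P γ h1 h2 => h P γ h1 fun k hk => he k hk ▸ h2 k hk

lemma psum (d u v i : ℕ) (hi : 1 ≤ i) (hi2 : i ≤ d - 3) :
    ∑ j ∈ Finset.range i, (if j = 0 then u else if j = d - 3 then v else 1) = u + (i - 1) := by
  induction i, hi using Nat.le_induction with
  | base => simp
  | succ i hi ih =>
    rw [Finset.sum_range_succ, ih (by omega), if_neg (by omega), if_neg (by omega)]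
    omega

lemma sigma_vals (d u v : ℕ) (hd : 5 ≤ d) (huv : u + v = 5) (sp : ℕ → ℝ)
    (h : IsSigmaOf d (d - 2) (fun i => if i = 0 then u else if i = d - 3 then v else 1) sp) :
    (∀ k < u, sp k = 1) ∧ (∀ k, u ≤ k → k + v ≤ d → sp k = (-1) ^ (k + 1 - u)) ∧
    (∀ k, d < k + v → k ≤ d → sp k = (-1) ^ (d - 3)) := by
  obtain ⟨-, -, h⟩ := h
  refine ⟨fun k hk => ?_, fun k h1 h2 => ?_, fun k h1 h2 => ?_⟩
  · simpa using h 0 k (by omega) (by simp) (by simpa using hk)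
  · refine h (k + 1 - u) k (by omega) ?_ ?_
    · rw [psum d u v _ (by omega) (by omega)]; omega
    · rw [psum d u v _ (by omega) (by omega)]; omega
  · refine h (d - 3) k (by omega) ?_ ?_
    · rw [psum d u v _ (by omega) (by omega)]; omega
    · rw [Finset.sum_range_succ, psum d u v _ (by omega) (by omega), if_neg (by omega), if_pos rfl]
      omega

lemma first_vals (d : ℕ) (hd : 5 ≤ d) (sp : ℕ → ℝ)
    (h : IsSigmaOf d 4 (fun i => if i = 2 then d - 2 else 1) sp) :
    ∀ k ≤ d, sp k = if k = 1 ∨ k = d then -1 else 1 := by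
  obtain ⟨-, -, h⟩ := h
  intro k hk
  have e0 := h 0 k (by omega)
  have e1 := h 1 k (by omega)
  have e2 := h 2 k (by omega)
  have e3 := h 3 k (by omega)
  simp [Finset.sum_range_succ] at e0 e1 e2 e3
  split_ifs with hc
  · rcases hc with rfl | rfl
    · rw [e1 (by omega) (by omega)]
    · rw [e3 (by omega) (by omega)]; norm_num
  · by_cases h0 : k = 0
    · exact e0 h0
    · rw [e2 (by omega) (by omega)]

end CanonSP

/-- for `d ≥ 5`, the three sign patterns `Σ_{1,1,d-2,1}`,
`Σ_{2,1,…,1,3}` (with `d-4` middle components equal to `1`) and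
`Σ_{3,1,…,1,2}` (with `d-4` middle components equal to `1`) are canonical. -/
theorem three_sign_patterns_canonical (d : ℕ) (hd : 5 ≤ d) :
    (∀ sp : ℕ → ℝ,
      IsSigmaOf d 4 (fun i => if i = 2 then d - 2 else 1) sp → IsCanonical d sp) ∧
    (∀ sp : ℕ → ℝ,
      IsSigmaOf d (d - 2) (fun i => if i = 0 then 2 else if i = d - 3 then 3 else 1) sp →
        IsCanonical d sp) ∧
    (∀ sp : ℕ → ℝ,
      IsSigmaOf d (d - 2) (fun i => if i = 0 then 3 else if i = d - 3 then 2 else 1) sp →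
        IsCanonical d sp) := by
  have hb := CanonSP.base d hd
  have par : ∀ m n : ℕ, m % 2 = n % 2 → ((-1 : ℝ)) ^ m = (-1) ^ n := by
    intro m n hmn
    rw [neg_one_pow_eq_pow_mod_two m, neg_one_pow_eq_pow_mod_two n, hmn]
  refine ⟨fun sp h => ?_, fun sp h => ?_, fun sp h => ?_⟩
  · exact CanonSP.canon_congr d _ sp hb (CanonSP.first_vals d hd sp h)
  · have hc := CanonSP.canon_m d _ (CanonSP.canon_r d _ hb (if_neg (by omega)))
    refine CanonSP.canon_congr d _ sp hc fun k hk => ?_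
    obtain ⟨v1, v2, v3⟩ := CanonSP.sigma_vals d 2 3 hd rfl sp h
    simp only [or_true, if_true]
    by_cases h1 : k < 2
    · rw [v1 k h1]
      obtain rfl | rfl : k = 0 ∨ k = 1 := by omega
      · rw [if_pos (by omega)]; norm_num
      · rw [if_neg (by omega)]; norm_num
    · by_cases h2 : k + 3 ≤ d
      · rw [v2 k (by omega) h2, if_neg (by omega), par (k + 1 - 2) (k + 1) (by omega), pow_succ]
        ring
      · rw [v3 k (by omega) hk]
        split_ifs with h3
        · rw [par (d - 3) k (by omega)]; ring
        · rw [par (d - 3) (k + 1) (by omega), pow_succ]; ring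
  · have hc := CanonSP.canon_m d _ hb
    refine CanonSP.canon_congr d _ sp hc fun k hk => ?_
    obtain ⟨v1, v2, v3⟩ := CanonSP.sigma_vals d 3 2 hd rfl sp h
    by_cases h1 : k < 3
    · rw [v1 k h1]
      obtain rfl | rfl | rfl : k = 0 ∨ k = 1 ∨ k = 2 := by omega
      · rw [if_neg (by omega)]; norm_num
      · rw [if_pos (by omega)]; norm_num
      · rw [if_neg (by omega)]; norm_num
    · by_cases h2 : k + 2 ≤ d
      · rw [v2 k (by omega) h2, if_neg (by omega), par (k + 1 - 3) k (by omega)]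
        ring
      · rw [v3 k (by omega) hk]
        split_ifs with h3
        · rw [par (d - 3) (k + 1) (by omega), pow_succ]
        · rw [par (d - 3) k (by omega)]; ring
end

section
/- Let r ≥ 2 and δ be integers with r² < δ < (r+1)² and δ−r odd, let m ≥ (δ−r+1)/2 and q ≥ (δ−r+1)/2 be integers, let n = r, and set τ₁ = m−(δ−r+1)/2, τ₂ = q−(δ−r+1)/2 and d = m+n+q−1 = δ+τ₁+τ₂. Then for every triple of nonnegative integers (m*, n*, q*) with m*+n*+q* = d−2, m* ≥ τ₁ and q* ≥ τ₂, there exists a monic hyperbolic polynomial P of degree d with all coefficients nonzero realizing the sign pattern Σ_{m,n,q}, with all d moduli of roots pairwise distinct, having exactly two positive roots β < α, exactly m* negative roots of modulus larger than α, exactly n* negative roots of modulus strictly between β and α, and exactly q* negative roots of modulus smaller than β. -/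
open Polynomial

/-- The sign pattern `Σ_{m,n,q}` (`m` signs `+1`, then `n` signs `-1`, then `q` signs
`+1`) is realizable by a monic hyperbolic degree-`d` polynomial with all coefficients
nonzero and pairwise distinct moduli of roots, having exactly two positive roots
`β < α`, exactly `mstar` negative roots of modulus larger than `α`, exactly `nstar`
negative roots of modulus strictly between `β` and `α`, and exactly `qstar` negative
roots of modulus smaller than `β`. -/
def CountsRealizable (d m n q mstar nstar qstar : ℕ) : Prop :=
  ∃ (P : Polynomial ℝ) (γ : Fin d → ℝ) (sp : ℕ → ℝ),
    HypOrdered d P γ ∧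
    IsSigmaOf d 3 (fun i => if i = 0 then m else if i = 1 then n else q) sp ∧
    Realizes d P sp ∧
    ∃ β α : ℝ, 0 < β ∧ β < α ∧
      (∃ i, γ i = β) ∧ (∃ i, γ i = α) ∧
      Nat.card {j : Fin d // 0 < γ j} = 2 ∧
      Nat.card {j : Fin d // γ j < 0 ∧ α < |γ j|} = mstar ∧
      Nat.card {j : Fin d // γ j < 0 ∧ β < |γ j| ∧ |γ j| < α} = nstar ∧
      Nat.card {j : Fin d // γ j < 0 ∧ |γ j| < β} = qstar

/-- sign of the j-th root -/
noncomputable def rsg (a b j : ℕ) : ℝ := if j = a ∨ j = b then 1 else -1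

/-- sign of the k-th coefficient -/
noncomputable def csg (n q k : ℕ) : ℝ := if q ≤ k ∧ k < q + n then -1 else 1

noncomputable def rpol (d a b : ℕ) (u : ℕ → ℝ) : Polynomial ℝ :=
  ∏ j ∈ Finset.range d, (X - C (rsg a b j * u j))

def GoodCfg (d a b n q : ℕ) : Prop :=
  ∃ u : ℕ → ℝ, (∀ i < d, 0 < u i) ∧ (∀ i j, i < j → j < d → u i < u j) ∧
    ∀ k ≤ d, 0 < csg n q k * (rpol d a b u).coeff k

lemma cont_prod (s : Finset ℕ) (c : ℕ → ℝ → ℝ) (hc : ∀ j, Continuous (c j)) :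
    ∀ k, Continuous fun t => (∏ j ∈ s, (X - C (c j t))).coeff k := by
  classical
  induction s using Finset.induction_on with
  | empty => intro k; simpa using continuous_const
  | insert x s hx ih =>
    intro k
    simp only [Finset.prod_insert hx, sub_mul, coeff_sub, coeff_C_mul]
    refine Continuous.sub ?_ ((hc x).mul (ih k))
    cases k with
    | zero => simpa using continuous_const
    | succ k => simpa [coeff_X_mul] using ih k

lemma rpol_one (D a b : ℕ) (hab : a < b) (hb : b < D + 2) :
    rpol (D + 2) a b (fun _ => 1) = (X - 1) ^ 2 * (X + 1) ^ D := by
  have h : ∀ j ∈ Finset.range (D + 2), (X - C (rsg a b j * 1) : Polynomial ℝ)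
      = if j ∈ ({a, b} : Finset ℕ) then X - 1 else X + 1 := by
    intro j _
    simp only [rsg, Finset.mem_insert, Finset.mem_singleton, mul_one]
    split_ifs <;> simp
  unfold rpol
  rw [Finset.prod_congr rfl h, Finset.prod_ite, Finset.prod_const, Finset.prod_const]
  have hs : ({a, b} : Finset ℕ) ⊆ Finset.range (D + 2) := by
    intro x; simp only [Finset.mem_insert, Finset.mem_singleton, Finset.mem_range]; omega
  have h1 : Finset.filter (fun j => j ∈ ({a, b} : Finset ℕ)) (Finset.range (D + 2)) = {a, b} := by
    rw [Finset.filter_mem_eq_inter, Finset.inter_eq_right.2 hs]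
  have h2 := Finset.card_filter_add_card_filter_not (s := Finset.range (D + 2))
    (fun j => j ∈ ({a, b} : Finset ℕ))
  have h3 : ({a, b} : Finset ℕ).card = 2 := Finset.card_pair (by omega)
  rw [h1, h3, Finset.card_range] at h2
  rw [h1, h3]
  congr 2
  omega

lemma coeff_form (N k : ℕ) :
    ((N : ℝ) + 2) * (N + 1) * (((X - 1) ^ 2 * (X + 1) ^ N : Polynomial ℝ)).coeff k
      = ((N + 2).choose k : ℝ) * (((N : ℝ) + 2 - 2 * k) ^ 2 - (N + 2)) := by
  have h : ((X - 1) ^ 2 * (X + 1) ^ N : Polynomial ℝ)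
      = (X + 1) ^ (N + 2) - C 4 * (X * (X + 1) ^ N) := by
    have : (C 4 : Polynomial ℝ) = 4 := rfl
    rw [this]; ring
  rw [h, coeff_sub, coeff_C_mul, coeff_X_add_one_pow]
  cases k with
  | zero => simp; ring
  | succ k =>
    rw [coeff_X_mul, coeff_X_add_one_pow]
    have h1 : ((N + 2 : ℕ) : ℝ) * ((N + 1).choose k) = ((N + 2).choose (k + 1)) * ((k + 1 : ℕ) : ℝ) := by
      exact_mod_cast Nat.add_one_mul_choose_eq (N + 1) k
    have h2 : ((N + 1 : ℕ) : ℝ) * (N.choose k) = ((N + 1).choose k) * ((N : ℝ) + 1 - k) := by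
      rcases le_or_gt k (N + 1) with hk | hk
      · have := Nat.choose_mul_succ_eq N k
        have h3 : ((N + 1 - k : ℕ) : ℝ) = (N : ℝ) + 1 - k := by
          rw [Nat.cast_sub hk]; push_cast; ring
        rw [← h3]
        rw [mul_comm]; exact_mod_cast this
      · rw [Nat.choose_eq_zero_of_lt hk, Nat.choose_eq_zero_of_lt (by omega : N < k)]; simp
    push_cast at h1 h2 ⊢
    linear_combination (-4 * ((N : ℝ) + 2)) * h2 - 4 * ((N : ℝ) + 1 - k) * h1

lemma base_good (r δ a b q : ℕ) (hr : 2 ≤ r) (h1 : r ^ 2 < δ) (h2 : δ < (r + 1) ^ 2)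
    (hq : 2 * q + r = δ + 1) (hab : a < b) (hb : b < δ) : GoodCfg δ a b r q := by
  obtain ⟨N, rfl⟩ : ∃ N, δ = N + 2 := ⟨δ - 2, by omega⟩
  have key : ∀ k ≤ N + 2, 0 < csg r q k * (rpol (N + 2) a b (fun j => 1 + 0 * j)).coeff k := by
    intro k hk
    have e : (fun j : ℕ => (1 : ℝ) + 0 * j) = fun _ => 1 := by funext j; simp
    rw [e, rpol_one N a b hab hb]
    have hf := coeff_form N k
    have hc : (0 : ℝ) < (N + 2).choose k := by exact_mod_cast Nat.choose_pos hk
    have hq' : 2 * (q : ℝ) + r = N + 3 := by exact_mod_cast hq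
    have h1' : (r : ℝ) ^ 2 < N + 2 := by exact_mod_cast h1
    have h2' : (N : ℝ) + 2 < (r + 1) ^ 2 := by exact_mod_cast h2
    have hr' : (2 : ℝ) ≤ r := by exact_mod_cast hr
    set c := (((X - 1) ^ 2 * (X + 1) ^ N : Polynomial ℝ)).coeff k
    have hp : (0 : ℝ) < ((N : ℝ) + 2) * (N + 1) := by positivity
    unfold csg
    split_ifs with h
    · have g1 : (q : ℝ) ≤ k := by exact_mod_cast h.1
      have g2 : (k : ℝ) + 1 ≤ q + r := by exact_mod_cast h.2
      have : ((N : ℝ) + 2 - 2 * k) ^ 2 - (N + 2) < 0 := by nlinarith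
      have := mul_neg_of_pos_of_neg hc this
      rw [← hf] at this
      nlinarith [(pos_iff_neg_of_mul_neg this).1 hp]
    · have : 0 < ((N : ℝ) + 2 - 2 * k) ^ 2 - (N + 2) := by
        rcases lt_or_ge k q with g | g
        · have g1 : (k : ℝ) + 1 ≤ q := by exact_mod_cast g
          nlinarith
        · have g2 : (q : ℝ) + r ≤ k := by
            have : q + r ≤ k := by omega
            exact_mod_cast this
          nlinarith
      have := mul_pos hc this
      rw [← hf] at this
      rw [one_mul]
      exact (pos_iff_pos_of_mul_pos this).1 hp
  have ev : ∀ᶠ t : ℝ in nhds 0, ∀ k ∈ Finset.range (N + 3),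
      0 < csg r q k * (rpol (N + 2) a b (fun j => 1 + t * j)).coeff k := by
    rw [Filter.eventually_all_finset]
    intro k hk
    have hcont : Continuous fun t : ℝ =>
        csg r q k * (rpol (N + 2) a b (fun j => 1 + t * j)).coeff k :=
      continuous_const.mul (cont_prod _ (fun j t => rsg a b j * (1 + t * j))
        (fun j => by fun_prop) k)
    exact hcont.continuousAt.eventually (lt_mem_nhds (key k (by simp at hk; omega)))
  obtain ⟨t, ht, ht0⟩ := ((ev.filter_mono nhdsWithin_le_nhds).and
    (self_mem_nhdsWithin : Set.Ioi (0 : ℝ) ∈ nhdsWithin 0 (Set.Ioi 0))).exists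
  have ht0 : 0 < t := ht0
  refine ⟨fun j => 1 + t * j, fun i _ => by positivity, fun i j hij _ => ?_,
    fun k hk => ht k (by simp; omega)⟩
  have : (i : ℝ) < j := by exact_mod_cast hij
  simp only
  nlinarith

lemma small_step (d a b n q : ℕ) (hq : 1 ≤ q) (h : GoodCfg d a b n q) :
    GoodCfg (d + 1) (a + 1) (b + 1) n (q + 1) := by
  obtain ⟨u, hu, hm, hc⟩ := h
  set P := rpol d a b u with hP
  have ev : ∀ᶠ t : ℝ in nhds 0, (∀ k ∈ Finset.range (d + 1),
      0 < csg n q k * (P.coeff k + t * P.coeff (k + 1))) ∧ ∀ i ∈ Finset.range d, t < u i := by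
    refine Filter.Eventually.and ?_ ?_
    · rw [Filter.eventually_all_finset]
      intro k hk
      have hcont : Continuous fun t : ℝ =>
        csg n q k * (P.coeff k + t * P.coeff (k + 1)) := by fun_prop
      refine hcont.continuousAt.eventually (lt_mem_nhds ?_)
      simpa using hc k (by simp at hk; omega)
    · rw [Filter.eventually_all_finset]
      intro i hi
      exact gt_mem_nhds (hu i (by simpa using hi))
  obtain ⟨t, ⟨ht, htu⟩, ht0⟩ := ((ev.filter_mono nhdsWithin_le_nhds).and
    (self_mem_nhdsWithin : Set.Ioi (0 : ℝ) ∈ nhdsWithin 0 (Set.Ioi 0))).exists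
  have ht0 : 0 < t := ht0
  let v : ℕ → ℝ := fun j => Nat.casesOn j t u
  have hv : rpol (d + 1) (a + 1) (b + 1) v = P * (X + C t) := by
    unfold rpol
    rw [Finset.prod_range_succ']
    congr 1
    · refine Finset.prod_congr rfl fun j _ => ?_
      simp [rsg, v]
    · simp [rsg, v]
  refine ⟨v, ?_, ?_, ?_⟩
  · rintro (_ | i) hi
    · exact ht0
    · exact hu i (by omega)
  · rintro (_ | i) (_ | j) hij hj
    · omega
    · exact htu j (by simp; omega)
    · omega
    · exact hm i j (by omega) (by omega)
  · rw [hv]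
    rintro (_ | k) hk
    · have := hc 0 (by omega)
      have e1 : csg n q 0 = 1 := by simp [csg]; omega
      have e2 : csg n (q + 1) 0 = 1 := by simp [csg]
      rw [e1, one_mul] at this
      rw [e2]
      simp [mul_add, mul_coeff_zero]
      positivity
    · have := ht k (by simp; omega)
      have e1 : csg n (q + 1) (k + 1) = csg n q k := by
        unfold csg; congr 1; apply propext; omega
      rw [e1, mul_add, coeff_add, coeff_mul_X, coeff_mul_C, mul_comm _ t]
      exact this

lemma rpol_monic (d a b : ℕ) (u : ℕ → ℝ) : (rpol d a b u).Monic :=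
  monic_prod_of_monic _ _ fun j _ => monic_X_sub_C _

lemma rpol_deg (d a b : ℕ) (u : ℕ → ℝ) : (rpol d a b u).natDegree = d := by
  unfold rpol
  rw [natDegree_prod_of_monic _ _ fun j _ => monic_X_sub_C _]
  simp only [natDegree_X_sub_C, Finset.sum_const, Finset.card_range, smul_eq_mul, mul_one]

lemma large_step (d a b n q : ℕ) (ha : a < d) (hb : b < d) (hq : q + n ≤ d)
    (h : GoodCfg d a b n q) : GoodCfg (d + 1) a b n q := by
  obtain ⟨u, hu, hm, hc⟩ := h
  set P := rpol d a b u with hP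
  have ev : ∀ᶠ t : ℝ in nhds 0, (∀ k ∈ Finset.range (d + 1),
      0 < csg n q k * (P.coeff k + t * (X * P).coeff k)) ∧ ∀ i ∈ Finset.range d, t * u i < 1 := by
    refine Filter.Eventually.and ?_ ?_
    · rw [Filter.eventually_all_finset]
      intro k hk
      have hcont : Continuous fun t : ℝ =>
        csg n q k * (P.coeff k + t * (X * P).coeff k) := by fun_prop
      refine hcont.continuousAt.eventually (lt_mem_nhds ?_)
      simpa using hc k (by simp at hk; omega)
    · rw [Filter.eventually_all_finset]
      intro i hi
      have hcont : Continuous fun t : ℝ => t * u i := by fun_prop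
      exact hcont.continuousAt.eventually (gt_mem_nhds (by simp))
  obtain ⟨t, ⟨ht, htu⟩, ht0⟩ := ((ev.filter_mono nhdsWithin_le_nhds).and
    (self_mem_nhdsWithin : Set.Ioi (0 : ℝ) ∈ nhdsWithin 0 (Set.Ioi 0))).exists
  have ht0 : 0 < t := ht0
  let v : ℕ → ℝ := fun j => if j < d then u j else t⁻¹
  have hv : rpol (d + 1) a b v = P * (X + C t⁻¹) := by
    unfold rpol
    rw [Finset.prod_range_succ]
    congr 1
    · refine Finset.prod_congr rfl fun j hj => ?_
      simp [v, Finset.mem_range.1 hj]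
    · have : ¬ (d = a ∨ d = b) := by omega
      simp [rsg, v, this]
  refine ⟨v, ?_, ?_, ?_⟩
  · intro i hi
    simp only [v]
    split_ifs with g
    · exact hu i g
    · positivity
  · intro i j hij hj
    have hi : i < d := by omega
    simp only [v, hi, if_true]
    split_ifs with g
    · exact hm i j hij g
    · rw [lt_inv_comm₀ (hu i hi) ht0, ← one_div, lt_div_iff₀ (hu i hi)]
      exact htu i (by simpa using hi)
  · intro k hk
    rcases Nat.lt_or_ge k (d + 1) with g | g
    · have := ht k (by simpa using g)
      rw [hv, mul_add, coeff_add, coeff_mul_C, mul_comm P X]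
      have e : csg n q k * ((X * P).coeff k + P.coeff k * t⁻¹)
          = (csg n q k * (P.coeff k + t * (X * P).coeff k)) * t⁻¹ := by
        field_simp; ring
      rw [e]; positivity
    · have : k = d + 1 := by omega
      subst this
      have h1 := (rpol_monic (d + 1) a b v).coeff_natDegree
      rw [rpol_deg] at h1
      rw [h1]
      have : csg n q (d + 1) = 1 := by simp [csg]; omega
      rw [this]; norm_num

lemma small_iter (d a b n q : ℕ) (hq : 1 ≤ q) (h : GoodCfg d a b n q) (t : ℕ) :
    GoodCfg (d + t) (a + t) (b + t) n (q + t) := by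
  induction t with
  | zero => exact h
  | succ t ih => exact small_step (d + t) (a + t) (b + t) n (q + t) (by omega) ih

lemma large_iter (d a b n q : ℕ) (ha : a < d) (hb : b < d) (hq : q + n ≤ d)
    (h : GoodCfg d a b n q) (t : ℕ) : GoodCfg (d + t) a b n q := by
  induction t with
  | zero => exact h
  | succ t ih => exact large_step (d + t) a b n q (by omega) (by omega) (by omega) ih

lemma card_sub (d : ℕ) (p : Fin d → Prop) (s : Finset ℕ) (hs : ∀ x ∈ s, x < d)
    (h : ∀ j : Fin d, p j ↔ (j : ℕ) ∈ s) : Nat.card {j : Fin d // p j} = s.card := by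
  rw [← Nat.card_eq_finsetCard s]
  refine Nat.card_congr
    { toFun := fun j => ⟨j.1, (h j.1).1 j.2⟩
      invFun := fun x => ⟨⟨x.1, hs x.1 x.2⟩, (h _).2 x.2⟩
      left_inv := fun _ => rfl
      right_inv := fun _ => rfl }

theorem counts_of_good (d m n q ms ns qs : ℕ) (hm : 1 ≤ m) (hn : 1 ≤ n) (hq : 1 ≤ q)
    (hd : m + n + q = d + 1) (hs : ms + ns + qs + 2 = d)
    (h : GoodCfg d qs (qs + ns + 1) n q) : CountsRealizable d m n q ms ns qs := by
  obtain ⟨u, hu, hmono, hc⟩ := h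
  have hmono' : ∀ i j, i < d → j < d → (u i < u j ↔ i < j) := by
    intro i j hi hj
    rcases lt_trichotomy i j with g | g | g
    · simp [g, hmono i j g hj]
    · simp [g]
    · have := hmono j i g hi
      constructor
      · intro; linarith
      · omega
  have habs : ∀ j : Fin d, |rsg qs (qs + ns + 1) j * u j| = u j := by
    intro j
    have := hu j j.2
    unfold rsg
    split_ifs <;> simp [abs_of_pos this]
  have hpos : ∀ j : Fin d, 0 < rsg qs (qs + ns + 1) j * u j ↔
      ((j : ℕ) = qs ∨ (j : ℕ) = qs + ns + 1) := by
    intro j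
    have := hu j j.2
    unfold rsg
    split_ifs with g
    · simp [g, this]
    · simp [g, this.le]
  have hneg : ∀ j : Fin d, rsg qs (qs + ns + 1) j * u j < 0 ↔
      ¬ ((j : ℕ) = qs ∨ (j : ℕ) = qs + ns + 1) := by
    intro j
    have := hu j j.2
    unfold rsg
    split_ifs with g
    · simp [g, this.le]
    · simp [g, this]
  refine ⟨rpol d qs (qs + ns + 1) u, fun j => rsg qs (qs + ns + 1) j * u j,
    fun k => csg n q (d - k), ⟨?_, ?_, ?_⟩, ⟨?_, ?_, ?_⟩, ?_, u qs, u (qs + ns + 1),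
    hu _ (by omega), hmono _ _ (by omega) (by omega), ⟨⟨qs, by omega⟩, ?_⟩,
    ⟨⟨qs + ns + 1, by omega⟩, ?_⟩, ?_, ?_, ?_, ?_⟩
  · unfold rpol
    rw [Finset.prod_range]
  · intro j hj h0
    have := hc j hj
    simp [h0] at this
  · intro i j hij
    simp only [habs]
    exact hmono i j hij j.2
  · intro i hi
    simp only
    split_ifs <;> assumption
  · simp [Finset.sum_range_succ]; omega
  · intro i k hi h1 h2
    simp only [csg]
    interval_cases i <;> simp [Finset.sum_range_succ] at h1 h2 ⊢ <;> omega
  · intro k hk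
    exact hc (d - k) (by omega)
  · simp [rsg]
  · simp [rsg]
  · rw [card_sub d _ {qs, qs + ns + 1}]
    · exact Finset.card_pair (by omega)
    · intro x; simp; omega
    · intro j; rw [hpos]; simp
  · rw [card_sub d _ (Finset.Ico (qs + ns + 2) d)]
    · simp; omega
    · intro x; simp
    · intro j
      rw [hneg, habs, hmono' _ _ (by omega) j.2]
      have := j.2
      simp; omega
  · rw [card_sub d _ (Finset.Ico (qs + 1) (qs + ns + 1))]
    · simp
    · intro x; simp; omega
    · intro j
      rw [hneg, habs, hmono' _ _ (by omega) j.2, hmono' _ _ j.2 (by omega)]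
      simp; omega
  · rw [card_sub d _ (Finset.range qs)]
    · simp
    · intro x; simp; omega
    · intro j
      rw [hneg, habs, hmono' _ _ j.2 (by omega)]
      simp; omega

/-- part (1) of Theorem 3: the case `r² < δ < (r+1)²`, `δ - r` odd. -/
theorem counts_realizable_odd_case (r δ m q n τ₁ τ₂ d : ℕ)
    (hr : 2 ≤ r) (hδ₁ : r ^ 2 < δ) (hδ₂ : δ < (r + 1) ^ 2) (hodd : Odd (δ - r))
    (hm : (δ - r + 1) / 2 ≤ m) (hq : (δ - r + 1) / 2 ≤ q) (hn : n = r)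
    (hτ₁ : τ₁ = m - (δ - r + 1) / 2) (hτ₂ : τ₂ = q - (δ - r + 1) / 2)
    (hd : d = m + n + q - 1) :
    ∀ mstar nstar qstar : ℕ, mstar + nstar + qstar = d - 2 →
      τ₁ ≤ mstar → τ₂ ≤ qstar →
      CountsRealizable d m n q mstar nstar qstar := by
  intro ms ns qs hs h1 h2
  obtain ⟨c, hc⟩ := hodd
  have hrδ : r ^ 2 < δ := hδ₁
  have hrr : 2 * r ≤ r ^ 2 := by nlinarith
  subst hn
  have hq0 : 2 * ((δ - n + 1) / 2) + n = δ + 1 := by omega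
  set q0 := (δ - n + 1) / 2 with hq0d
  have hb := base_good n δ (qs - τ₂) (qs - τ₂ + ns + 1) q0 hr hδ₁ hδ₂ hq0 (by omega) (by omega)
  have hl := large_iter _ _ _ _ _ (by omega) (by omega) (by omega) hb τ₁
  have hsm := small_iter _ _ _ _ _ (by omega) hl τ₂
  have e1 : δ + τ₁ + τ₂ = d := by omega
  have e2 : qs - τ₂ + τ₂ = qs := by omega
  have e3 : qs - τ₂ + ns + 1 + τ₂ = qs + ns + 1 := by omega
  have e4 : q0 + τ₂ = q := by omega
  rw [e1, e2, e3, e4] at hsm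
  exact counts_of_good d m n q ms ns qs (by omega) (by omega) (by omega) (by omega) (by omega) hsm
end

section
/- Let r ≥ 2 and δ be integers with r² < δ < (r+1)² and δ−r even, let m ≥ (δ−r)/2 and q ≥ (δ−r)/2 be integers, let n = r+1, and set τ₁ = m−(δ−r)/2, τ₂ = q−(δ−r)/2 and d = m+n+q−1 = δ+τ₁+τ₂. Then for every triple of nonnegative integers (m*, n*, q*) with m*+n*+q* = d−2, m* ≥ τ₁ and q* ≥ τ₂, there exists a monic hyperbolic polynomial P of degree d with all coefficients nonzero realizing the sign pattern Σ_{m,n,q}, with all d moduli of roots pairwise distinct, having exactly two positive roots β < α, exactly m* negative roots of modulus larger than α, exactly n* negative roots of modulus strictly between β and α, and exactly q* negative roots of modulus smaller than β. -/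
open Polynomial

noncomputable def sgq (q n i : ℕ) : ℝ := if q ≤ i ∧ i < q + n then -1 else 1

def RR (d a b q n : ℕ) : Prop :=
  ∃ γ : Fin d → ℝ, StrictMono (fun j : Fin d => |γ j|) ∧ (∀ i, γ i ≠ 0) ∧
    (∀ i, 0 < γ i ↔ ((i : ℕ) = a ∨ (i : ℕ) = b)) ∧
    ∀ i ≤ d, 0 < sgq q n i * (∏ j : Fin d, (X - C (γ j))).coeff i

lemma prod_monic_coeff {d : ℕ} (γ : Fin d → ℝ) :
    (∏ j : Fin d, (X - C (γ j))).coeff d = 1 ∧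
    (∏ j : Fin d, (X - C (γ j))).coeff (d+1) = 0 := by
  have h1 : (∏ j : Fin d, (X - C (γ j))).Monic := monic_prod_of_monic _ _ (fun i _ => monic_X_sub_C _)
  have h2 : (∏ j : Fin d, (X - C (γ j))).natDegree = d := by
    rw [natDegree_prod_of_monic _ _ (fun i _ => monic_X_sub_C _)]; simp
  constructor
  · have := h1.coeff_natDegree; rwa [h2] at this
  · apply coeff_eq_zero_of_natDegree_lt; omega

lemma RR_big {d a b q n : ℕ} (hb : b < d) (ha : a < d) (hq : q + n ≤ d) (h : RR d a b q n) :
    RR (d + 1) a b q n := by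
  obtain ⟨γ, h1, h2, h3, h4⟩ := h
  set P := ∏ j : Fin d, (X - C (γ j)) with hP
  have e1 : ∀ᶠ M : ℝ in Filter.atTop, ∀ i ∈ Finset.range (d+1),
      0 < sgq q n i * (P * (X - C (-M))).coeff i := by
    rw [Filter.eventually_all_finset]
    intro i hi
    have hi' := h4 i (by simpa [Nat.lt_succ_iff] using hi)
    have e : ∀ M : ℝ, sgq q n i * (P * (X - C (-M))).coeff i
        = sgq q n i * (P * X).coeff i + (sgq q n i * P.coeff i) * M := by
      intro M
      rw [mul_sub, coeff_sub, coeff_mul_C]; ring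
    simp_rw [e]
    exact (Filter.tendsto_atTop_add_const_left _ _
      (Filter.tendsto_id.const_mul_atTop hi')).eventually_gt_atTop 0
  have e2 : ∀ᶠ M : ℝ in Filter.atTop, ∀ i : Fin d, |γ i| < M := by
    rw [Filter.eventually_all]
    intro i; exact Filter.eventually_gt_atTop _
  obtain ⟨M, hM1, hM2, hM3⟩ := (e1.and (e2.and (Filter.eventually_gt_atTop 0))).exists
  refine ⟨Fin.snoc γ (-M), ?_, ?_, ?_, ?_⟩
  · intro i j hij
    induction j using Fin.lastCases with
    | last =>
      induction i using Fin.lastCases with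
      | last => exact absurd hij (lt_irrefl _)
      | cast i => simpa [abs_of_pos hM3] using hM2 i
    | cast j =>
      induction i using Fin.lastCases with
      | last => exact absurd hij (not_lt.2 (Fin.le_last _))
      | cast i =>
        simpa using h1 (Fin.castSucc_lt_castSucc_iff.1 hij)
  · intro i
    induction i using Fin.lastCases with
    | last => simpa using hM3.ne'
    | cast i => simpa using h2 i
  · intro i
    induction i using Fin.lastCases with
    | last =>
      simp only [Fin.snoc_last, Fin.val_last]
      constructor
      · intro h; linarith
      · intro h; omega
    | cast i => simpa using h3 i
  · intro i hi
    rcases Nat.lt_or_ge i (d+1) with h | h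
    · have := hM1 i (by simpa using h)
      rw [Fin.prod_univ_castSucc]
      simpa using this
    · obtain rfl : i = d + 1 := by omega
      rw [(prod_monic_coeff _).1]
      unfold sgq
      rw [if_neg (by omega)]; norm_num

lemma RR_small {d a b q n : ℕ} (hq : 1 ≤ q) (h : RR d a b q n) :
    RR (d + 1) (a+1) (b+1) (q+1) n := by
  obtain ⟨γ, h1, h2, h3, h4⟩ := h
  set P := ∏ j : Fin d, (X - C (γ j)) with hP
  have e1 : ∀ᶠ M : ℝ in nhdsWithin 0 (Set.Ioi 0), ∀ i ∈ Finset.range (d+1),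
      0 < sgq q n i * (P * (X - C (-M))).coeff (i+1) := by
    rw [Filter.eventually_all_finset]
    intro i hi
    have hi' := h4 i (by simpa [Nat.lt_succ_iff] using hi)
    have e : ∀ M : ℝ, sgq q n i * (P * (X - C (-M))).coeff (i+1)
        = sgq q n i * P.coeff i + (sgq q n i * P.coeff (i+1)) * M := by
      intro M
      rw [mul_sub, coeff_sub, coeff_mul_C, coeff_mul_X]; ring
    simp_rw [e]
    apply Filter.Eventually.filter_mono nhdsWithin_le_nhds
    have hc : Continuous fun M : ℝ => sgq q n i * P.coeff i + (sgq q n i * P.coeff (i+1)) * M := by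
      fun_prop
    exact (hc.tendsto 0).eventually (lt_mem_nhds (by simpa using hi'))
  have e2 : ∀ᶠ M : ℝ in nhdsWithin 0 (Set.Ioi 0), ∀ i : Fin d, M < |γ i| := by
    rw [Filter.eventually_all]
    intro i
    apply Filter.Eventually.filter_mono nhdsWithin_le_nhds
    exact gt_mem_nhds (abs_pos.2 (h2 i))
  obtain ⟨M, hM1, hM2, hM3⟩ := (e1.and (e2.and self_mem_nhdsWithin)).exists
  replace hM3 : 0 < M := hM3
  refine ⟨Fin.cons (-M) γ, ?_, ?_, ?_, ?_⟩
  · intro i j hij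
    induction i using Fin.cases with
    | zero =>
      induction j using Fin.cases with
      | zero => exact absurd hij (lt_irrefl _)
      | succ j => simpa [abs_of_pos hM3] using hM2 j
    | succ i =>
      induction j using Fin.cases with
      | zero => exact absurd hij (not_lt.2 (Fin.zero_le _))
      | succ j => simpa using h1 (Fin.succ_lt_succ_iff.1 hij)
  · intro i
    induction i using Fin.cases with
    | zero => simpa using hM3.ne'
    | succ i => simpa using h2 i
  · intro i
    induction i using Fin.cases with
    | zero =>
      simp only [Fin.cons_zero, Fin.val_zero]
      constructor
      · intro h; linarith
      · intro h; omega
    | succ i => simpa using h3 i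
  · intro i hi
    rw [Fin.prod_univ_succ, mul_comm (X - C _)]
    simp only [Fin.cons_zero, Fin.cons_succ]
    rcases i with _ | i
    · have := h4 0 (by omega)
      have s0 : sgq q n 0 = 1 := by unfold sgq; rw [if_neg (by omega)]
      have s1 : sgq (q+1) n 0 = 1 := by unfold sgq; rw [if_neg (by omega)]
      rw [s0, one_mul] at this
      rw [s1, one_mul, mul_sub, coeff_sub, coeff_mul_C, coeff_mul_X_zero]
      have := mul_pos this hM3
      rw [← hP]
      linarith
    · have s1 : sgq (q+1) n (i+1) = sgq q n i := by
        unfold sgq; congr 1; apply propext; omega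
      rw [s1]
      exact hM1 i (by simp; omega)

lemma cont_coeff {ι : Type*} (s : Finset ι) (f : ι → ℝ → ℝ) (hf : ∀ i, Continuous (f i)) :
    ∀ k, Continuous fun e => (∏ j ∈ s, (X - C (f j e))).coeff k := by
  classical
  induction s using Finset.induction with
  | empty => intro k; simp only [Finset.prod_empty]; exact continuous_const
  | insert x s hx ih =>
    intro k
    simp only [Finset.prod_insert hx, mul_comm (X - C _), mul_sub, coeff_sub, coeff_mul_C]
    refine Continuous.sub ?_ ((ih k).mul (hf x))
    rcases k with _ | k
    · simp only [coeff_mul_X_zero]; exact continuous_const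
    · simp only [coeff_mul_X]; exact ih k

lemma coeff_base (N j : ℕ) :
    (((X : ℝ[X]) - C 1)^2 * (X + 1)^N).coeff j * ((N+2 : ℝ) * (N+1))
      = (Nat.choose (N+2) j : ℝ) * ((N + 2 - 2 * j : ℝ)^2 - (N+2)) := by
  have e : ((X : ℝ[X]) - C 1)^2 * (X + 1)^N = (X+1)^(N+2) - C 4 * ((X+1)^N * X) := by
    have : (C 4 : ℝ[X]) = 4 := rfl
    rw [this, C_1]; ring
  rw [e, coeff_sub, coeff_C_mul, coeff_X_add_one_pow]
  rcases j with _ | i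
  · simp; ring
  · rw [coeff_mul_X, coeff_X_add_one_pow]
    rcases Nat.lt_or_ge (N+1) i with h | h
    · rw [Nat.choose_eq_zero_of_lt (show N < i by omega), Nat.choose_eq_zero_of_lt (by omega)]; simp
    · have h1 : ((N+2).choose (i+1) : ℝ) * (i+1) = (N+2) * (N+1).choose i := by
        have := Nat.add_one_mul_choose_eq (N+1) i
        exact_mod_cast this.symm
      have h2 : ((N+1).choose i : ℝ) * (N+1-i) = (N+1) * N.choose i := by
        have := Nat.choose_mul_succ_eq N i
        have h3 : ((N + 1 - i : ℕ) : ℝ) = N + 1 - i := by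
          rw [Nat.cast_sub (by omega)]; push_cast; ring
        rw [← h3]
        have h4 : ((N.choose i * (N+1) : ℕ) : ℝ) = (((N+1).choose i * (N+1-i) : ℕ) : ℝ) := by
          rw [this]
        push_cast at h4
        push_cast
        linarith
      push_cast
      linear_combination 4 * (N+1-i : ℝ) * h1 + 4 * (N + 2 : ℝ) * h2

lemma prod_base (d a b : ℕ) (hab : a < b) (hb : b < d) :
    (∏ j : Fin d, (X - C (if (j:ℕ) = a ∨ (j:ℕ) = b then (1:ℝ) else -1)))
      = ((X : ℝ[X]) - C 1)^2 * (X + 1)^(d-2) := by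
  have h : ∀ j : Fin d, (X - C (if (j:ℕ) = a ∨ (j:ℕ) = b then (1:ℝ) else -1))
      = if j ∈ ({⟨a, by omega⟩, ⟨b, hb⟩} : Finset (Fin d)) then (X - C 1 : ℝ[X]) else X + 1 := by
    intro j
    simp only [Finset.mem_insert, Finset.mem_singleton, Fin.ext_iff]
    split_ifs <;> simp
  have hc : ({⟨a, by omega⟩, ⟨b, hb⟩} : Finset (Fin d)).card = 2 := by
    rw [Finset.card_pair]; simp [Fin.ext_iff]; omega
  simp_rw [h]
  rw [Finset.prod_ite, Finset.prod_const, Finset.prod_const, Finset.filter_mem_eq_inter,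
    Finset.univ_inter, hc, Finset.filter_not, Finset.filter_mem_eq_inter,
    Finset.univ_inter, ← Finset.compl_eq_univ_sdiff, Finset.card_compl, hc, Fintype.card_fin]

lemma RR_base (r k a b : ℕ) (h1 : r^2 < r + 2*k) (h2 : r + 2*k < (r+1)^2)
    (hab : a < b) (hb : b < r + 2*k) : RR (r + 2*k) a b k (r+1) := by
  set d := r + 2*k with hd
  let s : Fin d → ℝ := fun j => if (j:ℕ) = a ∨ (j:ℕ) = b then (1:ℝ) else -1
  have hs : ∀ j, |s j| = 1 := by intro j; simp only [s]; split_ifs <;> simp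
  have e1 : ∀ᶠ e : ℝ in nhdsWithin 0 (Set.Ioi 0), ∀ i ∈ Finset.range (d+1),
      0 < sgq k (r+1) i * (∏ j : Fin d, (X - C (s j * (1 + e * j)))).coeff i := by
    rw [Filter.eventually_all_finset]
    intro i hi
    apply Filter.Eventually.filter_mono nhdsWithin_le_nhds
    have hc : Continuous fun e : ℝ =>
        sgq k (r+1) i * (∏ j : Fin d, (X - C (s j * (1 + e * j)))).coeff i :=
      continuous_const.mul (cont_coeff _ (fun j e => s j * (1 + e * (j:ℕ))) (by fun_prop) i)
    refine (hc.tendsto 0).eventually (lt_mem_nhds ?_)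
    simp only [zero_mul, add_zero, mul_one, s]
    rw [prod_base d a b hab hb]
    have hN := coeff_base (d-2) i
    have hdd : ((d - 2 : ℕ) : ℝ) = (d:ℝ) - 2 := by
      rw [Nat.cast_sub (by omega)]; norm_num
    rw [hdd, show d - 2 + 2 = d by omega] at hN
    set c := (((X : ℝ[X]) - C 1)^2 * (X + 1)^(d-2)).coeff i
    have hid : i ≤ d := by simpa [Nat.lt_succ_iff] using hi
    have hch : (0:ℝ) < d.choose i := by exact_mod_cast Nat.choose_pos hid
    have hd2 : (2:ℝ) ≤ d := by exact_mod_cast (by omega : 2 ≤ d)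
    have hpos : (0:ℝ) < ((d:ℝ) - 2 + 2) * (d - 2 + 1) := by
      apply mul_pos <;> linarith
    have h1' : (r:ℝ)^2 < d := by exact_mod_cast h1
    have h2' : (d:ℝ) < (r+1)^2 := by exact_mod_cast h2
    have hdr : (d:ℝ) = r + 2 * k := by rw [hd]; push_cast; ring
    have hr0 : (0:ℝ) ≤ r := Nat.cast_nonneg _
    suffices H : 0 < sgq k (r+1) i * ((d - 2 * i : ℝ)^2 - d) by
      have : 0 < sgq k (r+1) i * c * (((d:ℝ) - 2 + 2) * (d - 2 + 1)) := by
        rw [mul_assoc, hN]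
        have := mul_pos hch H
        have e : (d:ℝ) - 2 + 2 = d := by ring
        rw [e]
        linarith
      exact pos_of_mul_pos_left this hpos.le
    unfold sgq
    split_ifs with hcase
    · have c1 : (k:ℝ) ≤ i := by exact_mod_cast hcase.1
      have c2 : (i:ℝ) ≤ k + r := by exact_mod_cast (by omega : i ≤ k + r)
      have : (d - 2 * i : ℝ)^2 ≤ r^2 := by
        apply sq_le_sq'  <;> linarith
      linarith
    · rcases Nat.lt_or_ge i k with h | h
      · have c1 : (i:ℝ) + 1 ≤ k := by exact_mod_cast h
        have : ((r:ℝ)+1)^2 ≤ (d - 2 * i : ℝ)^2 := by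
          apply pow_le_pow_left₀ <;> linarith
        linarith
      · have c1 : (k:ℝ) + r + 1 ≤ i := by exact_mod_cast (by omega : k + r + 1 ≤ i)
        have : ((r:ℝ)+1)^2 ≤ (2 * i - d : ℝ)^2 := by
          apply pow_le_pow_left₀ <;> linarith
        nlinarith
  obtain ⟨e, he, he0⟩ := (e1.and self_mem_nhdsWithin).exists
  replace he0 : 0 < e := he0
  have hp : ∀ j : Fin d, 0 < 1 + e * (j:ℕ) := fun j => by positivity
  refine ⟨fun j => s j * (1 + e * j), ?_, ?_, ?_, ?_⟩
  · intro i j hij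
    simp only [abs_mul, hs, one_mul, abs_of_pos (hp _)]
    have : (i:ℝ) < j := by exact_mod_cast hij
    have := mul_lt_mul_of_pos_left this he0
    linarith
  · intro i
    have : s i ≠ 0 := by intro h; have := hs i; rw [h] at this; simp at this
    exact mul_ne_zero this (hp i).ne'
  · intro i
    rw [mul_pos_iff_of_pos_right (hp i)]
    simp only [s]
    split_ifs with h
    · simp [h]
    · simp only [h, iff_false]; norm_num
  · intro i hi
    exact he i (by simp; omega)

lemma RR_final {d a b m n q : ℕ} (hm : 1 ≤ m) (hn : 1 ≤ n) (hq : 1 ≤ q) (hd : d + 1 = m + n + q)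
    (hab : a < b) (hb : b < d) (h : RR d a b q n) :
    CountsRealizable d m n q (d - 1 - b) (b - a - 1) a := by
  obtain ⟨γ, h1, h2, h3, h4⟩ := h
  have ha' : 0 < γ ⟨a, by omega⟩ := (h3 _).2 (Or.inl rfl)
  have hb' : 0 < γ ⟨b, hb⟩ := (h3 _).2 (Or.inr rfl)
  have hlt : ∀ i j, |γ i| < |γ j| ↔ i < j := fun i j => h1.lt_iff_lt
  have hneg : ∀ i, γ i < 0 ↔ ¬ ((i:ℕ) = a ∨ (i:ℕ) = b) := by
    intro i
    rw [← h3, not_lt]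
    exact ⟨le_of_lt, fun h => lt_of_le_of_ne h (h2 i)⟩
  refine ⟨_, γ, fun k => sgq m n k, ⟨rfl, ?_, h1⟩, ⟨?_, ?_, ?_⟩, ?_,
    |γ ⟨a, by omega⟩|, |γ ⟨b, hb⟩|, abs_pos.2 (h2 _), (hlt _ _).2 hab,
    ⟨_, (abs_of_pos ha').symm⟩, ⟨_, (abs_of_pos hb').symm⟩, ?_, ?_, ?_, ?_⟩
  · intro j hj h0
    have := h4 j hj
    rw [h0] at this; simp at this
  · intro i hi
    interval_cases i <;> simp <;> assumption
  · simp [Finset.sum_range_succ]; omega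
  · intro i k hi
    interval_cases i <;> simp [Finset.sum_range_succ, sgq] <;> intros <;> omega
  · intro k hk
    have := h4 (d - k) (by omega)
    have e : sgq q n (d-k) = sgq m n k := by
      unfold sgq; congr 1; apply propext; omega
    rwa [e] at this
  · simp_rw [h3]
    rw [Nat.card_eq_fintype_card, Fintype.card_subtype]
    have : (Finset.univ.filter fun i : Fin d => (i:ℕ) = a ∨ (i:ℕ) = b)
        = {⟨a, by omega⟩, ⟨b, hb⟩} := by
      ext i; simp [Fin.ext_iff]
    rw [this, Finset.card_pair]
    simp [Fin.ext_iff]; omega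
  · simp_rw [hlt, hneg]
    rw [Nat.card_eq_fintype_card, Fintype.card_subtype]
    have : (Finset.univ.filter fun i : Fin d => ¬((i:ℕ) = a ∨ (i:ℕ) = b) ∧ ⟨b, hb⟩ < i)
        = Finset.Ioi ⟨b, hb⟩ := by
      ext i; simp [Fin.lt_def]; omega
    rw [this, Fin.card_Ioi]
  · simp_rw [hlt, hneg]
    rw [Nat.card_eq_fintype_card, Fintype.card_subtype]
    have : (Finset.univ.filter fun i : Fin d => ¬((i:ℕ) = a ∨ (i:ℕ) = b) ∧
        ⟨a, by omega⟩ < i ∧ i < ⟨b, hb⟩)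
        = Finset.Ioo ⟨a, by omega⟩ ⟨b, hb⟩ := by
      ext i; simp [Fin.lt_def]; omega
    rw [this, Fin.card_Ioo]
  · simp_rw [hlt, hneg]
    rw [Nat.card_eq_fintype_card, Fintype.card_subtype]
    have : (Finset.univ.filter fun i : Fin d => ¬((i:ℕ) = a ∨ (i:ℕ) = b) ∧
        i < ⟨a, by omega⟩)
        = Finset.Iio ⟨a, by omega⟩ := by
      ext i; simp [Fin.lt_def]; omega
    rw [this, Fin.card_Iio]

/-- part (2) of Theorem 3: the case `r² < δ < (r+1)²`, `δ - r` even. -/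
theorem counts_realizable_even_case (r δ m q n τ₁ τ₂ d : ℕ)
    (hr : 2 ≤ r) (hδ₁ : r ^ 2 < δ) (hδ₂ : δ < (r + 1) ^ 2) (heven : Even (δ - r))
    (hm : (δ - r) / 2 ≤ m) (hq : (δ - r) / 2 ≤ q) (hn : n = r + 1)
    (hτ₁ : τ₁ = m - (δ - r) / 2) (hτ₂ : τ₂ = q - (δ - r) / 2)
    (hd : d = m + n + q - 1) :
    ∀ mstar nstar qstar : ℕ, mstar + nstar + qstar = d - 2 →
      τ₁ ≤ mstar → τ₂ ≤ qstar →
      CountsRealizable d m n q mstar nstar qstar := by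
  intro ms ns qs hsum hms hqs
  obtain ⟨k, hk⟩ := heven
  have hrδ : r < δ := by nlinarith
  obtain rfl : δ = r + 2 * k := by omega
  have hk2 : (r + 2 * k - r) / 2 = k := by omega
  rw [hk2] at hm hq hτ₁ hτ₂
  have hk1 : 1 ≤ k := by omega
  have base := RR_base r k (qs - τ₂) (qs - τ₂ + ns + 1) hδ₁ hδ₂ (by omega) (by omega)
  have small : ∀ t, RR (r + 2*k + t) (qs - τ₂ + t) (qs - τ₂ + ns + 1 + t) (k + t) (r+1) := by
    intro t
    induction t with
    | zero => exact base
    | succ t ih => exact RR_small (q := k + t) (by omega) ih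
  have big : ∀ t, RR (r + 2*k + τ₂ + t) (qs - τ₂ + τ₂) (qs - τ₂ + ns + 1 + τ₂) (k + τ₂) (r+1) := by
    intro t
    induction t with
    | zero => exact small τ₂
    | succ t ih => exact RR_big (d := r + 2*k + τ₂ + t) (by omega) (by omega) (by omega) ih
  have fin := big τ₁
  rw [show r + 2*k + τ₂ + τ₁ = d by omega, show qs - τ₂ + τ₂ = qs by omega,
    show qs - τ₂ + ns + 1 + τ₂ = qs + ns + 1 by omega, show k + τ₂ = q by omega, ← hn] at fin
  have := RR_final (m := m) (by omega) (by omega) (by omega) (by omega) (by omega) (by omega) fin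
  rwa [show d - 1 - (qs + ns + 1) = ms by omega, show qs + ns + 1 - qs - 1 = ns by omega] at this
end

section
/- Let r ≥ 2 be an integer, δ = r², and let τ₁, τ₂ ≥ 0 be integers; set d = δ+τ₁+τ₂. Then: (a) for every triple of nonnegative integers (m*, n*, q*) with m*+n*+q* = d−2, m* ≥ τ₁+1 and q* ≥ τ₂, there exists a monic hyperbolic polynomial P of degree d with all coefficients nonzero realizing the sign pattern Σ_{m,n,q} with m = τ₁+r(r−1)/2+1, n = r, q = τ₂+r(r−1)/2, with all d moduli of roots pairwise distinct, having exactly two positive roots β < α, exactly m* negative roots of modulus larger than α, exactly n* negative roots of modulus strictly between β and α, and exactly q* negative roots of modulus smaller than β; and (b) the same holds for the sign pattern Σ_{m,n,q} with m = τ₁+r(r−1)/2, n = r, q = τ₂+r(r−1)/2+1, for every triple (m*, n*, q*) with m*+n*+q* = d−2, m* ≥ τ₁ and q* ≥ τ₂+1. -/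
open Polynomial

namespace SqCase

open Finset Filter Topology

noncomputable def sg (a b i : ℕ) : ℝ := if i = a ∨ i = b then 1 else -1

noncomputable def sgm (m n k : ℕ) : ℝ := if k < m then 1 else if k < m + n then -1 else 1

noncomputable def pol (d a b : ℕ) (c : ℕ → ℝ) : ℝ[X] :=
  ∏ i ∈ range d, (X - C (sg a b i * c i))

def Good (d m n a b : ℕ) : Prop :=
  ∃ c : ℕ → ℝ, (∀ i < d, 0 < c i) ∧ (∀ i j, i < j → j < d → c i < c j) ∧
    ∀ k ≤ d, 0 < sgm m n k * (pol d a b c).coeff (d - k)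

lemma coeff_cont (s : Finset ℕ) (g : ℕ → ℝ → ℝ) (hg : ∀ i, Continuous (g i)) :
    ∀ k, Continuous fun e => (∏ i ∈ s, (X - C (g i e))).coeff k := by
  classical
  induction s using Finset.induction_on with
  | empty => intro k; simp only [prod_empty]; exact continuous_const
  | insert a s ha ih =>
    intro k
    simp only [prod_insert ha]
    cases k with
    | zero =>
      simp only [mul_coeff_zero, coeff_sub, coeff_X_zero, coeff_C_zero]
      exact (continuous_const.sub (hg a)).mul (ih 0)
    | succ k =>
      simp only [sub_mul, coeff_sub, coeff_X_mul, coeff_C_mul]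
      exact (ih k).sub ((hg a).mul (ih (k+1)))

lemma ev_pos (A B : ℝ) (h : 0 < A ∨ (A = 0 ∧ 0 < B)) :
    ∀ᶠ e in 𝓝[>] (0:ℝ), 0 < A + e * B := by
  rcases h with h | ⟨rfl, h⟩
  · have : Continuous fun e : ℝ => A + e * B := by fun_prop
    have h2 : Tendsto (fun e : ℝ => A + e * B) (𝓝 0) (𝓝 (A + 0 * B)) := this.tendsto 0
    exact (h2.eventually (lt_mem_nhds (by simpa using h))).filter_mono nhdsWithin_le_nhds
  · filter_upwards [self_mem_nhdsWithin] with e he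
    have : (0:ℝ) < e := he
    have := mul_pos this h
    linarith

lemma ev_self : ∀ᶠ e in 𝓝[>] (0:ℝ), 0 < e := by
  filter_upwards [self_mem_nhdsWithin] with e he using he

lemma small {d m n a b : ℕ} (hmn : m + n ≤ d) (h : Good d m n a b) :
    Good (d + 1) m n (a + 1) (b + 1) := by
  obtain ⟨c, hpos, hmono, hs⟩ := h
  have e1 : ∀ᶠ e in 𝓝[>] (0:ℝ), ∀ i ∈ range d, e < c i := by
    rw [Finset.eventually_all]
    intro i hi
    exact (gt_mem_nhds (hpos i (by simpa using hi))).filter_mono nhdsWithin_le_nhds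
  have e2 : ∀ᶠ e in 𝓝[>] (0:ℝ), ∀ k ∈ range d, 0 < sgm m n k * (pol d a b c).coeff (d - k - 1)
       * 0 + sgm m n k * (pol d a b c).coeff (d - k) + e * (sgm m n k * (pol d a b c).coeff (d - k + 1)) := by
    rw [Finset.eventually_all]
    intro k hk
    apply ev_pos
    left
    have := hs k (by simp at hk; omega)
    linarith
  have e2' : ∀ᶠ e in 𝓝[>] (0:ℝ), 0 < sgm m n d * (pol d a b c).coeff 0
       + e * (sgm m n d * (pol d a b c).coeff 1) := by
    apply ev_pos
    left
    simpa using hs d le_rfl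
  obtain ⟨e, he0, h1, h2, h3⟩ := (ev_self.and
    (e1.and (e2.and e2'))).exists
  have he0 : 0 < e := he0
  have hpol : pol (d+1) (a+1) (b+1) (fun i => if i = 0 then e else c (i - 1)) =
      pol d a b c * (X + C e) := by
    unfold pol
    rw [prod_range_succ']
    congr 1
    · apply prod_congr rfl
      intro i _
      simp [sg]
    · simp [sg]
  refine ⟨fun i => if i = 0 then e else c (i - 1), ?_, ?_, ?_⟩
  · intro i hi
    dsimp only
    split_ifs with h
    · exact he0
    · exact hpos _ (by omega)
  · intro i j hij hj
    have hj0 : j ≠ 0 := by omega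
    simp only [hj0, if_false]
    split_ifs with h
    · exact h1 _ (by simp; omega)
    · exact hmono _ _ (by omega) (by omega)
  · intro k hk
    rw [hpol]
    rcases Nat.lt_or_ge k (d+1) with hk' | hk'
    · have e3 : d + 1 - k = (d - k) + 1 := by omega
      rw [e3, mul_add, coeff_add, coeff_mul_X, coeff_mul_C]
      rcases Nat.lt_or_ge k d with hk2 | hk2
      · have := h2 k (by simpa using hk2)
        nlinarith
      · have : k = d := by omega
        subst this
        simp only [Nat.sub_self, zero_add]
        nlinarith
    · have : k = d + 1 := by omega
      subst this
      simp only [Nat.sub_self, mul_coeff_zero, coeff_add, coeff_X_zero, coeff_C_zero, zero_add]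
      have h5 := hs d le_rfl
      have h6 : sgm m n d = 1 := by
        unfold sgm; rw [if_neg (by omega), if_neg (by omega)]
      have h7 : sgm m n (d+1) = 1 := by
        unfold sgm; rw [if_neg (by omega), if_neg (by omega)]
      rw [h6] at h5
      rw [h7]
      simp only [Nat.sub_self] at h5
      rw [one_mul] at *
      exact mul_pos h5 he0

lemma pol_natDegree (d a b : ℕ) (c : ℕ → ℝ) : (pol d a b c).natDegree = d := by
  unfold pol
  rw [natDegree_prod_of_monic _ _ (fun i _ => monic_X_sub_C _)]
  simp only [natDegree_X_sub_C, sum_const, card_range, smul_eq_mul, mul_one]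

lemma large {d m n a b : ℕ} (hm : 1 ≤ m) (ha : a < d) (hb : b < d) (h : Good d m n a b) :
    Good (d + 1) (m + 1) n a b := by
  obtain ⟨c, hpos, hmono, hs⟩ := h
  have e1 : ∀ᶠ e in 𝓝[>] (0:ℝ), ∀ i ∈ range d, e < (c i)⁻¹ := by
    rw [Finset.eventually_all]
    intro i hi
    exact (gt_mem_nhds (inv_pos.2 (hpos i (by simpa using hi)))).filter_mono nhdsWithin_le_nhds
  have e2 : ∀ᶠ e in 𝓝[>] (0:ℝ), ∀ k ∈ range (d + 1), 0 < sgm m n k * (pol d a b c).coeff (d - k)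
       + e * (sgm m n k * (pol d a b c * X).coeff (d - k)) := by
    rw [Finset.eventually_all]
    intro k hk
    apply ev_pos
    left
    exact hs k (by simp at hk; omega)
  obtain ⟨e, he0, h1, h2⟩ := (ev_self.and
    (e1.and e2)).exists
  have he0 : 0 < e := he0
  have hpol : pol (d+1) a b (fun i => if i < d then c i else e⁻¹) =
      pol d a b c * (X + C e⁻¹) := by
    unfold pol
    rw [prod_range_succ]
    congr 1
    · apply prod_congr rfl
      intro i hi
      simp only [mem_range] at hi
      simp [hi]
    · have : ¬ (d = a ∨ d = b) := by omega
      simp [sg, this]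
  refine ⟨fun i => if i < d then c i else e⁻¹, ?_, ?_, ?_⟩
  · intro i hi
    dsimp only
    split_ifs with h
    · exact hpos _ h
    · exact inv_pos.2 he0
  · intro i j hij hj
    have hj0 : i < d := by omega
    simp only [hj0, if_true]
    split_ifs with h
    · exact hmono _ _ hij h
    · have := h1 i (by simpa using hj0)
      rwa [lt_inv_comm₀ he0 (hpos i hj0)] at this
  · intro k hk
    rw [hpol]
    cases k with
    | zero =>
      have h5 := hs 0 (Nat.zero_le _)
      have h6 : sgm m n 0 = 1 := by unfold sgm; rw [if_pos (by omega)]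
      have h7 : sgm (m+1) n 0 = 1 := by unfold sgm; rw [if_pos (by omega)]
      rw [h6] at h5
      rw [h7, Nat.sub_zero, mul_add, coeff_add, coeff_mul_X, coeff_mul_C,
        coeff_eq_zero_of_natDegree_lt (n := d + 1) (by rw [pol_natDegree]; omega)]
      simpa using h5
    | succ k =>
      have e3 : d + 1 - (k+1) = d - k := by omega
      have h7 : sgm (m+1) n (k+1) = sgm m n k := by
        unfold sgm
        simp only [add_lt_add_iff_right, show m + 1 + n = m + n + 1 by ring]
      rw [e3, h7, mul_add, coeff_add, coeff_mul_C]
      have := h2 k (by simp; omega)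
      have h8 : sgm m n k * ((pol d a b c * X).coeff (d - k) + (pol d a b c).coeff (d - k) * e⁻¹)
        = e⁻¹ * (sgm m n k * (pol d a b c).coeff (d - k)
       + e * (sgm m n k * (pol d a b c * X).coeff (d - k))) := by
        field_simp
        ring
      rw [h8]
      exact mul_pos (inv_pos.2 he0) this

lemma kraw (M j : ℕ) : ((M:ℝ)+2) * (M+1) * (((X - C 1)^2 * (X + C 1)^M : ℝ[X]).coeff j) =
    (Nat.choose (M+2) j : ℝ) * (((M:ℝ) + 2 - 2 * j)^2 - (M+2)) := by
  have A : ∀ n k : ℕ, ((n:ℝ)+1) * (n.choose k) = ((n+1).choose (k+1)) * (k+1) := by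
    intro n k; exact_mod_cast Nat.add_one_mul_choose_eq n k
  have B : ∀ n k : ℕ, ((n:ℝ)+1) * (n.choose k) = ((n+1).choose k) * (n+1-k) := by
    intro n k
    cases k with
    | zero => simp
    | succ k =>
      have h1 := A n k
      have h2 : ((n+1).choose (k+1) : ℝ) = n.choose k + n.choose (k+1) := by
        exact_mod_cast Nat.choose_succ_succ n k
      push_cast
      linear_combination (-(n:ℝ)-1) * h2 - h1
  have e : ((X - C 1)^2 * (X + C 1)^M : ℝ[X]) =
     (X+C 1)^M * X * X - C 2 * ((X+C 1)^M * X) + (X+C 1)^M := by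
    have : (C 2 : ℝ[X]) = 2 := rfl
    rw [this, C_1]; ring
  rw [e]
  simp only [coeff_add, coeff_sub, coeff_C_mul]
  rcases j with _ | _ | j
  · simp [C_1, coeff_X_add_one_pow]; ring
  · simp [C_1, coeff_X_add_one_pow]; ring
  · simp only [coeff_mul_X, C_1, coeff_X_add_one_pow]
    have a1 := A M j
    have a2 := A (M+1) (j+1)
    have b1 := B M (j+1)
    have b2 := B (M+1) (j+2)
    have b3 := B M (j+2)
    push_cast at *
    have t1 : ((M:ℝ)+2)*(M+1) * (M.choose j) = (M+1+1).choose (j+1+1) * (j+2)*(j+1) := by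
      rw [mul_assoc, a1]; linear_combination (↑j+1) * a2
    have t2 : ((M:ℝ)+2)*(M+1) * (M.choose (j+1)) = (M+1+1).choose (j+1+1) * (j+2)*(M-j) := by
      rw [mul_assoc, b1]; linear_combination (↑M-↑j) * a2
    have t3 : ((M:ℝ)+2)*(M+1) * (M.choose (j+2)) = (M+1+1).choose (j+1+1) * (M-j)*(M-j-1) := by
      rw [mul_assoc, b3]; linear_combination (↑M-↑j-1) * b2
    rw [show j+1+1 = j+2 by rfl] at *
    rw [show M+1+1 = M+2 by rfl] at *
    linear_combination t1 - 2 * t2 + t3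

lemma kraw_sign (M j : ℕ) (hj : j ≤ M + 2) (s : ℝ)
    (h : 0 < s * (((M:ℝ) + 2 - 2 * j)^2 - (M+2))) :
    0 < s * (((X - C 1)^2 * (X + C 1)^M : ℝ[X]).coeff j) := by
  have k := kraw M j
  have c : 0 < ((M+2).choose j : ℝ) := by exact_mod_cast Nat.choose_pos hj
  have p : 0 < ((M:ℝ)+2)*(M+1) := by positivity
  have : 0 < ((M:ℝ)+2)*(M+1) * (s * (((X - C 1)^2 * (X + C 1)^M : ℝ[X]).coeff j)) := by
    have := mul_pos c h
    calc _ < _ := this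
      _ = _ := by linear_combination (-s) * k
  exact (mul_pos_iff_of_pos_left p).1 this

lemma kraw_zero (M j : ℕ) (h : (((M:ℝ) + 2 - 2 * j)^2 - (M+2)) = 0) :
    (((X - C 1)^2 * (X + C 1)^M : ℝ[X]).coeff j) = 0 := by
  have k := kraw M j
  have p : 0 < ((M:ℝ)+2)*(M+1) := by positivity
  rw [h, mul_zero] at k
  exact (mul_eq_zero.1 k).resolve_left p.ne'

lemma pol_zero (N a b t : ℕ) (ha : a < N) (hb : b < N) (ht : t < N) (hab : a ≠ b) (hta : t ≠ a)
    (htb : t ≠ b) (v : ℝ) : pol N a b (fun i => if i = t then v else 1) =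
      (X - C 1)^2 * (X + C 1)^(N-3) * (X + C v) := by
  unfold pol
  rw [← mul_prod_erase _ _ (mem_range.2 ha),
    ← mul_prod_erase _ _ (mem_erase.2 ⟨hab.symm, mem_range.2 hb⟩),
    ← mul_prod_erase _ _ (mem_erase.2 ⟨htb, mem_erase.2 ⟨hta, mem_range.2 ht⟩⟩)]
  rw [prod_congr rfl (g := fun _ => (X + C 1 : ℝ[X]))]
  · rw [prod_const, card_erase_of_mem (mem_erase.2 ⟨htb, mem_erase.2 ⟨hta, mem_range.2 ht⟩⟩),
      card_erase_of_mem (mem_erase.2 ⟨hab.symm, mem_range.2 hb⟩),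
      card_erase_of_mem (mem_range.2 ha), card_range]
    simp only [sg, hta.symm, htb.symm, hta, htb, if_true, if_false, true_or, or_true, or_self]
    rw [show N - 1 - 1 - 1 = N - 3 by omega]
    simp
    ring
  · intro i hi
    simp only [mem_erase, mem_range] at hi
    simp [sg, hi.1, hi.2.1, hi.2.2.1]

/-- perturbation of the special root -/
lemma base1 (N m n : ℕ) (hN : 3 ≤ N) (u : ℝ)
    (h : ∀ k ≤ N, 0 < sgm m n k * ((N:ℝ) - 2 * (N - k : ℕ)) ^ 2 - sgm m n k * N ∨
      (((N:ℝ) - 2 * (N - k : ℕ)) ^ 2 = N ∧ k ≠ 0 ∧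
        0 < u * sgm m n k * (((N:ℝ) - 1 - 2 * (N - k : ℕ))^2 - (N - 1)))) :
    ∀ᶠ e in 𝓝[>] (0:ℝ), ∀ k ∈ range (N+1),
      0 < sgm m n k * ((X - C 1)^2 * (X + C 1)^(N-3) * (X + C (1 + e * u)) : ℝ[X]).coeff (N - k) := by
  rw [Finset.eventually_all]
  intro k hk
  have hk : k ≤ N := by simp at hk; omega
  obtain ⟨M, rfl⟩ : ∃ M, N = M + 3 := ⟨N - 3, by omega⟩
  have := ev_pos (sgm m n k * ((X - C 1)^2 * (X + C 1)^(M+1) : ℝ[X]).coeff (M + 3 - k))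
    (u * sgm m n k * ((X - C 1)^2 * (X + C 1)^M : ℝ[X]).coeff (M + 3 - k)) (by
      rcases h k hk with h | ⟨h1, h0, h2⟩
      · left
        apply kraw_sign _ _ (by omega)
        push_cast at h ⊢
        calc _ < _ := h
          _ = _ := by ring
      · right
        constructor
        · rw [kraw_zero, mul_zero]
          push_cast at h1 ⊢
          linear_combination h1
        · apply kraw_sign _ _ (by omega)
          push_cast at h2 ⊢
          calc _ < _ := h2
            _ = _ := by ring)
  filter_upwards [this] with e he
  have e1 : ((X - C 1)^2 * (X + C 1)^(M+3-3) * (X + C (1 + e * u)) : ℝ[X]) =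
     (X - C 1)^2 * (X + C 1)^(M+1) + C (e * u) * ((X - C 1)^2 * (X + C 1)^M) := by
    rw [Nat.add_sub_cancel, C_add]; ring
  rw [e1, coeff_add, coeff_C_mul]
  calc _ < _ := he
    _ = _ := by ring

lemma base2 (N m n a b t : ℕ) (ha : a < N) (hb : b < N) (ht : t < N) (hab : a ≠ b) (hta : t ≠ a)
    (htb : t ≠ b) (v : ℝ) (hv : 0 < v) (hc : (t = 0 ∧ v < 1) ∨ (t = N - 1 ∧ 1 < v))
    (h : ∀ k ∈ range (N+1),
      0 < sgm m n k * ((X - C 1)^2 * (X + C 1)^(N-3) * (X + C v) : ℝ[X]).coeff (N - k)) :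
    Good N m n a b := by
  let c : ℝ → ℕ → ℝ := fun e i => if i = t then v else 1 + e * i
  have hcont : ∀ i, Continuous fun e => c e i := by
    intro i
    by_cases hi : i = t
    · simp only [c, hi, if_true]; fun_prop
    · simp only [c, hi, if_false]; fun_prop
  have e1 : ∀ᶠ e in 𝓝[>] (0:ℝ), ∀ k ∈ range (N+1),
      0 < sgm m n k * (pol N a b (c e)).coeff (N - k) := by
    rw [Finset.eventually_all]
    intro k hk
    have h1 : Continuous fun e => sgm m n k * (pol N a b (c e)).coeff (N - k) :=
      continuous_const.mul (coeff_cont (range N) (fun i e => sg a b i * c e i)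
        (fun i => continuous_const.mul (hcont i)) (N - k))
    have h2 := h1.tendsto 0
    refine (h2.eventually (lt_mem_nhds ?_)).filter_mono nhdsWithin_le_nhds
    have h3 : c 0 = fun i => if i = t then v else 1 := by
      funext i; simp [c]
    rw [h3, pol_zero N a b t ha hb ht hab hta htb]
    exact h k hk
  have e2 : ∀ᶠ e in 𝓝[>] (0:ℝ), 1 < v → 1 + e * N < v := by
    by_cases hv1 : 1 < v
    · have h1 : Continuous fun e : ℝ => 1 + e * N := by fun_prop
      have h2 := h1.tendsto 0
      filter_upwards [(h2.eventually (gt_mem_nhds (show 1 + 0 * (N:ℝ) < v by simpa using hv1))).filter_mono nhdsWithin_le_nhds] with e he _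
      exact he
    · exact Eventually.of_forall fun e h => absurd h hv1
  obtain ⟨e, he0, h1, h2⟩ := (ev_self.and
    (e1.and e2)).exists
  have he0 : 0 < e := he0
  refine ⟨c e, ?_, ?_, fun k hk => h1 k (by simp; omega)⟩
  · intro i _
    simp only [c]
    split_ifs
    · exact hv
    · positivity
  · intro i j hij hj
    simp only [c]
    have hij' : (i:ℝ) < j := by exact_mod_cast hij
    have hiN : (i:ℝ) < N := by exact_mod_cast hij.trans hj
    have q1 := mul_lt_mul_of_pos_left hij' he0
    have q2 := mul_lt_mul_of_pos_left hiN he0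
    have q3 : 0 ≤ e * i := by positivity
    rcases hc with ⟨rfl, hc⟩ | ⟨rfl, hc⟩
    · rw [if_neg (by omega : ¬ j = 0)]
      split_ifs <;> linarith
    · rw [if_neg (by omega : ¬ i = N - 1)]
      have := h2 hc
      split_ifs <;> linarith

lemma base (N m n a b : ℕ) (hN : 3 ≤ N) (hab : a < b) (hb : b < N)
    (u : ℝ) (hu : (u = -1 ∧ 0 < a) ∨ (u = 1 ∧ b < N - 1))
    (h : ∀ k ≤ N, 0 < sgm m n k * ((N:ℝ) - 2 * (N - k : ℕ)) ^ 2 - sgm m n k * N ∨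
      (((N:ℝ) - 2 * (N - k : ℕ)) ^ 2 = N ∧ k ≠ 0 ∧
        0 < u * sgm m n k * (((N:ℝ) - 1 - 2 * (N - k : ℕ))^2 - (N - 1)))) :
    Good N m n a b := by
  have h1 := base1 N m n hN u h
  have h2 : ∀ᶠ e in 𝓝[>] (0:ℝ), e < 1 :=
    (gt_mem_nhds one_pos).filter_mono nhdsWithin_le_nhds
  obtain ⟨e, he0, h1, h2⟩ := (ev_self.and
    (h1.and h2)).exists
  have he0 : 0 < e := he0
  rcases hu with ⟨rfl, hu⟩ | ⟨rfl, hu⟩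
  · exact base2 N m n a b 0 (by omega) hb (by omega) (by omega) (by omega) (by omega) _
      (by linarith) (Or.inl ⟨rfl, by linarith⟩) h1
  · exact base2 N m n a b (N-1) (by omega) hb (by omega) (by omega) (by omega) (by omega) _
      (by linarith) (Or.inr ⟨rfl, by linarith⟩) h1

lemma card_fin_sub (d x y : ℕ) (hy : y ≤ d) (p : Fin d → Prop)
    (h : ∀ j : Fin d, p j ↔ x ≤ (j:ℕ) ∧ (j:ℕ) < y) : Nat.card {j : Fin d // p j} = y - x := by
  have : Nat.card {j : Fin d // p j} = Nat.card {n : ℕ // n ∈ Finset.Ico x y} := by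
    apply Nat.card_congr
    refine ⟨fun j => ⟨j.1, by rw [Finset.mem_Ico]; exact (h _).1 j.2⟩,
      fun n => ⟨⟨n.1, by have := Finset.mem_Ico.1 n.2; omega⟩, ?_⟩, ?_, ?_⟩
    · exact (h _).2 (Finset.mem_Ico.1 n.2)
    · intro j; rfl
    · intro j; rfl
  rw [this, Nat.card_eq_fintype_card, Fintype.card_coe, Nat.card_Ico]

lemma sg_pos {a b i : ℕ} (h : i = a ∨ i = b) : sg a b i = 1 := if_pos h
lemma sg_neg {a b i : ℕ} (h : ¬ (i = a ∨ i = b)) : sg a b i = -1 := if_neg h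

lemma convert_good {d m n q ms ns qs : ℕ} (hm : 1 ≤ m) (hn : 1 ≤ n) (hq : 1 ≤ q)
    (hd : m + n + q = d + 1) (hs : ms + ns + qs + 2 = d)
    (h : Good d m n qs (qs + ns + 1)) : CountsRealizable d m n q ms ns qs := by
  obtain ⟨c, hpos, hmono, hc⟩ := h
  have hlt : ∀ i j, i < d → j < d → (c i < c j ↔ i < j) := by
    intro i j hi hj
    refine ⟨fun h => ?_, fun h => hmono i j h hj⟩
    by_contra hh
    rcases Nat.eq_or_lt_of_le (not_lt.1 hh) with h2 | h2
    · subst h2; exact lt_irrefl _ h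
    · exact lt_asymm h (hmono j i h2 hi)
  set a := qs with ha
  set b := qs + ns + 1 with hb
  have habs : ∀ i < d, |sg a b i * c i| = c i := by
    intro i hi
    by_cases hh : i = a ∨ i = b
    · rw [sg_pos hh, one_mul, abs_of_pos (hpos i hi)]
    · rw [sg_neg hh, neg_one_mul, abs_neg, abs_of_pos (hpos i hi)]
  have hneg : ∀ i < d, (sg a b i * c i < 0 ↔ ¬ (i = a ∨ i = b)) := by
    intro i hi
    have := hpos i hi
    by_cases hh : i = a ∨ i = b
    · rw [sg_pos hh]; simp only [hh, not_true, iff_false]; linarith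
    · rw [sg_neg hh]; simp only [hh, not_false_iff, iff_true]; linarith
  have hpos' : ∀ i < d, (0 < sg a b i * c i ↔ (i = a ∨ i = b)) := by
    intro i hi
    have := hpos i hi
    by_cases hh : i = a ∨ i = b
    · rw [sg_pos hh]; simp only [hh, iff_true]; linarith
    · rw [sg_neg hh]; simp only [hh, iff_false]; linarith
  refine ⟨pol d a b c, fun j => sg a b j * c j, sgm m n, ⟨?_, ?_, ?_⟩, ⟨?_, ?_, ?_⟩, hc,
    c a, c b, hpos a (by omega), hmono a b (by omega) (by omega), ⟨⟨a, by omega⟩, ?_⟩,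
    ⟨⟨b, by omega⟩, ?_⟩, ?_, ?_, ?_, ?_⟩
  · exact (Fin.prod_univ_eq_prod_range (fun i => (X - C (sg a b i * c i) : ℝ[X])) d).symm
  · intro j hj h0
    have := hc (d - j) (by omega)
    rw [Nat.sub_sub_self hj, h0, mul_zero] at this
    exact lt_irrefl _ this
  · intro i j hij
    simp only [habs i i.2, habs j j.2]
    exact hmono _ _ hij j.2
  · intro i hi
    dsimp only
    split_ifs <;> assumption
  · simp [Finset.sum_range_succ]; omega
  · intro i k hi h1 h2
    interval_cases i
    · simp [Finset.sum_range_succ] at h1 h2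
      simp [sgm, h2]
    · simp [Finset.sum_range_succ] at h1 h2
      simp [sgm, h2, h1]
    · simp [Finset.sum_range_succ] at h1 h2
      rw [sgm, if_neg (by omega), if_neg (by omega)]; norm_num
  · simp [sg]
  · simp [sg]
  · have e : ∀ j : Fin d, 0 < sg a b j * c j ↔ j ∈ ({⟨a, by omega⟩, ⟨b, by omega⟩} : Finset (Fin d)) := by
      intro j
      rw [hpos' j j.2]
      simp [Fin.ext_iff]
    simp only [e]
    rw [Nat.card_eq_fintype_card, Fintype.card_coe, Finset.card_pair]
    simp [Fin.ext_iff]; omega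
  · rw [card_fin_sub d (b+1) d le_rfl]
    · omega
    · intro j
      have := j.2
      rw [hneg j j.2, habs j j.2, hlt b j (by omega) j.2]
      omega
  · rw [card_fin_sub d (a+1) b (by omega)]
    · omega
    · intro j
      have := j.2
      rw [hneg j j.2, habs j j.2, hlt j b j.2 (by omega), hlt a j (by omega) j.2]
      omega
  · rw [card_fin_sub d 0 a (by omega)]
    · omega
    · intro j
      have := j.2
      rw [hneg j j.2, habs j j.2, hlt j a j.2 (by omega)]
      omega

lemma small_iter {d m n a b : ℕ} (hmn : m + n ≤ d) (h : Good d m n a b) (t : ℕ) :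
    Good (d + t) m n (a + t) (b + t) := by
  induction t with
  | zero => exact h
  | succ t ih => exact small (d := d + t) (by omega) ih

lemma large_iter {d m n a b : ℕ} (hm : 1 ≤ m) (ha : a < d) (hb : b < d) (h : Good d m n a b)
    (t : ℕ) : Good (d + t) (m + t) n a b := by
  induction t with
  | zero => exact h
  | succ t ih => exact large (d := d + t) (m := m + t) (by omega) (by omega) (by omega) ih

lemma sq_cond (r S N m : ℕ) (u : ℝ) (hr : 2 ≤ r) (hN : N = r ^ 2) (hS : 2 * S + r = N)
    (hS1 : 1 ≤ S) (hm : (u = 1 ∧ m = S + 1) ∨ (u = -1 ∧ m = S)) (k : ℕ) (hk : k ≤ N) :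
    0 < sgm m r k * ((N:ℝ) - 2 * (N - k : ℕ)) ^ 2 - sgm m r k * N ∨
      (((N:ℝ) - 2 * (N - k : ℕ)) ^ 2 = N ∧ k ≠ 0 ∧
        0 < u * sgm m r k * (((N:ℝ) - 1 - 2 * (N - k : ℕ))^2 - (N - 1))) := by
  rw [Nat.cast_sub hk]
  have hN' : (N:ℝ) = r ^ 2 := by exact_mod_cast hN
  have hS' : (S:ℝ) = (r^2 - r) / 2 := by
    have : (2:ℝ) * S + r = N := by exact_mod_cast hS
    linarith
  have hr' : (2:ℝ) ≤ r := by exact_mod_cast hr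
  rcases lt_trichotomy k S with h | h | h
  · left
    rw [sgm, if_pos (by omega)]
    have : (k:ℝ) < S := by exact_mod_cast h
    rw [hN']; rw [hS'] at this
    nlinarith
  · right
    subst h
    rw [hN', hS']
    refine ⟨by ring, by omega, ?_⟩
    have : u * sgm m r k = 1 := by
      rcases hm with ⟨rfl, rfl⟩ | ⟨rfl, rfl⟩
      · rw [sgm, if_pos (by omega)]; norm_num
      · rw [sgm, if_neg (by omega), if_pos (by omega)]; norm_num
    rw [this]
    nlinarith
  rcases lt_trichotomy k (S + r) with h2 | h2 | h2
  · left
    rw [sgm, if_neg (by omega), if_pos (by omega)]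
    have h3 : (S:ℝ) < k := by exact_mod_cast h
    have h4 : (k:ℝ) < S + r := by exact_mod_cast h2
    rw [hN']; rw [hS'] at h3 h4
    nlinarith
  · right
    have : u * sgm m r k = -1 := by
      rcases hm with ⟨rfl, rfl⟩ | ⟨rfl, rfl⟩
      · rw [sgm, if_neg (by omega), if_pos (by omega)]; norm_num
      · rw [sgm, if_neg (by omega), if_neg (by omega)]; norm_num
    rw [this]
    subst h2
    push_cast
    rw [hN', hS']
    refine ⟨by ring, by omega, ?_⟩
    nlinarith
  · left
    rw [sgm, if_neg (by omega), if_neg (by omega)]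
    have : (S:ℝ) + r < k := by exact_mod_cast h2
    rw [hN']; rw [hS'] at this
    nlinarith

end SqCase

/-- part (3) of Theorem 3: the case `δ = r²`. -/
theorem counts_realizable_square_case (r τ₁ τ₂ d : ℕ)
    (hr : 2 ≤ r) (hd : d = r ^ 2 + τ₁ + τ₂) :
    (∀ mstar nstar qstar : ℕ, mstar + nstar + qstar = d - 2 →
      τ₁ + 1 ≤ mstar → τ₂ ≤ qstar →
      CountsRealizable d (τ₁ + r * (r - 1) / 2 + 1) r (τ₂ + r * (r - 1) / 2)
        mstar nstar qstar) ∧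
    (∀ mstar nstar qstar : ℕ, mstar + nstar + qstar = d - 2 →
      τ₁ ≤ mstar → τ₂ + 1 ≤ qstar →
      CountsRealizable d (τ₁ + r * (r - 1) / 2) r (τ₂ + r * (r - 1) / 2 + 1)
        mstar nstar qstar) := by
  have hS : 2 * (r * (r - 1) / 2) + r = r ^ 2 := by
    rw [Nat.mul_div_cancel' (Nat.even_mul_pred_self r).two_dvd]
    obtain ⟨s, rfl⟩ : ∃ s, r = s + 1 := ⟨r - 1, by omega⟩
    rw [Nat.add_sub_cancel]; ring
  have hr2 : 2 * r ≤ r ^ 2 := by nlinarith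
  have hS1 : 1 ≤ r * (r - 1) / 2 := by omega
  generalize r * (r - 1) / 2 = S at *
  constructor
  · intro ms ns qs h1 h2 h3
    obtain ⟨q', rfl⟩ : ∃ q', qs = q' + τ₂ := ⟨qs - τ₂, by omega⟩
    have g := SqCase.base (r^2) (S+1) r q' (q' + ns + 1) (by omega) (by omega) (by omega) 1
      (Or.inr ⟨rfl, by omega⟩) (SqCase.sq_cond r S (r^2) (S+1) 1 hr rfl hS hS1 (Or.inl ⟨rfl, rfl⟩))
    have g2 := SqCase.small_iter (by omega)
      (SqCase.large_iter (by omega) (by omega) (by omega) g τ₁) τ₂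
    rw [← hd] at g2
    apply SqCase.convert_good (by omega) (by omega) (by omega) (by omega) (by omega)
    convert g2 using 1 <;> omega
  · intro ms ns qs h1 h2 h3
    obtain ⟨q', rfl⟩ : ∃ q', qs = q' + τ₂ := ⟨qs - τ₂, by omega⟩
    have g := SqCase.base (r^2) S r q' (q' + ns + 1) (by omega) (by omega) (by omega) (-1)
      (Or.inl ⟨rfl, by omega⟩) (SqCase.sq_cond r S (r^2) S (-1) hr rfl hS hS1 (Or.inr ⟨rfl, rfl⟩))
    have g2 := SqCase.small_iter (by omega)
      (SqCase.large_iter (by omega) (by omega) (by omega) g τ₁) τ₂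
    rw [← hd] at g2
    apply SqCase.convert_good (by omega) (by omega) (by omega) (by omega) (by omega)
    convert g2 using 1 <;> omega
end
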